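/- arXiv:1107.1015 — 2 statements merged into one kernel-verified Lean document; each statement's English description precedes it below -/
import Mathlib

section
/- Let M > 0 and N ≥ 2. Let A_N be the N×N diagonal matrix with diagonal entries a_N(i) = −M + 2Mi/N for 1 ≤ i ≤ N, and let B_N be an N×N Hermitian matrix with distinct eigenvalues and operator norm ‖B_N‖ ≤ M. Then every z ∈ ℂ with I_N(z;A_N,B_N) = 0 satisfies |z| ≥ (π/2)·M^{−2}. -/
open MeasureTheory Matrix

namespace HCIZ

noncomputable instance (N : ℕ) : MeasurableSpace (Matrix (Fin N) (Fin N) ℂ) := borel _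

instance (N : ℕ) : BorelSpace (Matrix (Fin N) (Fin N) ℂ) := ⟨rfl⟩

/-- The number of cycles of a permutation (fixed points counted as cycles). -/
def cycleCount {d : ℕ} (π : Equiv.Perm (Fin d)) : ℕ := π.partition.parts.card

/-- `π` has cycle type `α` (1-cycles included). -/
def HasCycleType {d : ℕ} (π : Equiv.Perm (Fin d)) (α : d.Partition) : Prop :=
  π.partition.parts = α.parts

/-- The tuple `τ` consists of transpositions `(s_i t_i)`, `s_i < t_i`, with
`t_1 ≤ t_2 ≤ ⋯` (monotone condition). -/
def IsMonotoneTuple {d r : ℕ} (τ : Fin r → Equiv.Perm (Fin d)) : Prop :=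
  (∀ i, (τ i).IsSwap) ∧ Monotone fun i => (τ i).support.max

/-- The subgroup generated by `s` acts transitively on `Fin d`. -/
def GeneratesTransitively {d : ℕ} (s : Set (Equiv.Perm (Fin d))) : Prop :=
  ∀ x y : Fin d, ∃ g ∈ Subgroup.closure s, g x = y

/-- `H⃗^r(α,β)`: the number of monotone transitive factorizations of the identity
into `ρ σ τ_1 ⋯ τ_r` with `ρ` of cycle type `α` and `σ` of cycle type `β`. -/
noncomputable def Hr (d : ℕ) (α β : d.Partition) (r : ℕ) : ℕ :=
  Nat.card {T : Equiv.Perm (Fin d) × Equiv.Perm (Fin d) × (Fin r → Equiv.Perm (Fin d)) //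
    HasCycleType T.1 α ∧ HasCycleType T.2.1 β ∧ IsMonotoneTuple T.2.2 ∧
    T.1 * T.2.1 * (List.ofFn T.2.2).prod = 1 ∧
    GeneratesTransitively ({T.1, T.2.1} ∪ Set.range T.2.2)}

/-- `H̃^r(α,β)`: the same count without the transitivity requirement. -/
noncomputable def Hnt (d : ℕ) (α β : d.Partition) (r : ℕ) : ℕ :=
  Nat.card {T : Equiv.Perm (Fin d) × Equiv.Perm (Fin d) × (Fin r → Equiv.Perm (Fin d)) //
    HasCycleType T.1 α ∧ HasCycleType T.2.1 β ∧ IsMonotoneTuple T.2.2 ∧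
    T.1 * T.2.1 * (List.ofFn T.2.2).prod = 1}

/-- The monotone double Hurwitz number `H⃗_g(α,β) = H⃗^r(α,β)`,
`r = 2g - 2 + ℓ(α) + ℓ(β)`. -/
noncomputable def Hg (d g : ℕ) (α β : d.Partition) : ℕ :=
  Hr d α β (2 * g + α.parts.card + β.parts.card - 2)

/-- `m_r(π)`: monotone (not necessarily transitive) factorizations of `π`
into `r` transpositions. -/
noncomputable def mcount (d r : ℕ) (π : Equiv.Perm (Fin d)) : ℕ :=
  Nat.card {τ : Fin r → Equiv.Perm (Fin d) //
    IsMonotoneTuple τ ∧ (List.ofFn τ).prod = π}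

/-- Power sum `p_α(A) = ∏ Tr(A^{α_i})`. -/
noncomputable def pPoly {N : ℕ} (A : Matrix (Fin N) (Fin N) ℂ) {d : ℕ} (α : d.Partition) : ℂ :=
  (α.parts.map fun k => (A ^ k).trace).prod

/-- `φ_α = ∏ φ_{α_i}`. -/
noncomputable def momProd (Φ : ℕ → ℂ) {d : ℕ} (α : d.Partition) : ℂ :=
  (α.parts.map Φ).prod

/-- `C_{g,d}(A,B) = ∑_{α,β ⊢ d} (-1)^{d+ℓ(α)+ℓ(β)} H⃗_g(α,β)
(N^{-ℓ(α)} p_α(A)) (N^{-ℓ(β)} p_β(B))`. -/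
noncomputable def Cmat {N : ℕ} (g d : ℕ) (A B : Matrix (Fin N) (Fin N) ℂ) : ℂ :=
  ∑ α : d.Partition, ∑ β : d.Partition,
    (-1 : ℂ) ^ (d + α.parts.card + β.parts.card) * (Hg d g α β : ℂ) *
      (((N : ℂ) ^ α.parts.card)⁻¹ * pPoly A α) * (((N : ℂ) ^ β.parts.card)⁻¹ * pPoly B β)

/-- `C_{g,d}(Φ,Ψ) = ∑_{α,β ⊢ d} (-1)^{d+ℓ(α)+ℓ(β)} H⃗_g(α,β) φ_α ψ_β`. -/
noncomputable def Cseq (g d : ℕ) (Φ Ψ : ℕ → ℂ) : ℂ :=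
  ∑ α : d.Partition, ∑ β : d.Partition,
    (-1 : ℂ) ^ (d + α.parts.card + β.parts.card) * (Hg d g α β : ℂ) *
      momProd Φ α * momProd Ψ β

/-- The HCIZ integral `I_N(z;A,B)` with respect to a measure `μ` on `U(N)`. -/
noncomputable def hciz {N : ℕ} (μ : Measure (Matrix.unitaryGroup (Fin N) ℂ))
    (A B : Matrix (Fin N) (Fin N) ℂ) (z : ℂ) : ℂ :=
  ∫ U : Matrix.unitaryGroup (Fin N) ℂ,
    Complex.exp (-(z * (N : ℂ) *
      (A * (U : Matrix (Fin N) (Fin N) ℂ) * B *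
        ((U⁻¹ : Matrix.unitaryGroup (Fin N) ℂ) : Matrix (Fin N) (Fin N) ℂ)).trace)) ∂μ

/-- A free-energy branch for `I_N(·;A,B)` on the disc `D(0,ε)`: a holomorphic
function `F` with `F 0 = 0` and `exp (N² F z) = I_N(z;A,B)` on the disc. -/
def IsFreeEnergyBranch {N : ℕ} (μ : Measure (Matrix.unitaryGroup (Fin N) ℂ))
    (A B : Matrix (Fin N) (Fin N) ℂ) (ε : ℝ) (F : ℂ → ℂ) : Prop :=
  DifferentiableOn ℂ F (Metric.ball 0 ε) ∧ F 0 = 0 ∧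
    ∀ z ∈ Metric.ball (0 : ℂ) ε, Complex.exp ((N : ℂ) ^ 2 * F z) = hciz μ A B z

/-- The L² operator norm of a matrix. -/
noncomputable def opNorm {N : ℕ} (A : Matrix (Fin N) (Fin N) ℂ) : ℝ :=
  ‖Matrix.toEuclideanCLM (𝕜 := ℂ) A‖

/-- The all-ones partition `(1^d)`. -/
def onesPartition (d : ℕ) : d.Partition :=
  ⟨Multiset.replicate d 1, fun {i} hi => by
    rw [Multiset.eq_of_mem_replicate hi]; exact one_pos, by simp⟩

/-- The partition `(2,1^{d-2})` of `d`, for `d ≥ 2`. -/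
def twoOnesPartition (d : ℕ) (hd : 2 ≤ d) : d.Partition :=
  ⟨2 ::ₘ Multiset.replicate (d - 2) 1, fun {i} hi => by
    rcases Multiset.mem_cons.mp hi with h | h
    · omega
    · rw [Multiset.eq_of_mem_replicate h]; exact one_pos, by
    simp [Multiset.sum_cons]; omega⟩

section Symbols

variable {N : ℕ}

/-- The generating series `∏_{i ∈ Q} u / (1 - X_i u)`. -/
noncomputable def geomSeries (Q : Finset (Fin N)) : PowerSeries (MvPolynomial (Fin N) ℂ) :=
  ∏ i ∈ Q, PowerSeries.X * PowerSeries.mk fun n => (MvPolynomial.X i : MvPolynomial (Fin N) ℂ) ^ n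

/-- The complete homogeneous symmetric polynomial of degree `k + 1 - #Q` in the variables of `Q`. -/
noncomputable def hPoly (k : ℕ) (Q : Finset (Fin N)) : MvPolynomial (Fin N) ℂ :=
  PowerSeries.coeff (k + 1) (geomSeries Q)

theorem hPoly_empty (k : ℕ) : hPoly k (∅ : Finset (Fin N)) = 0 := by
  simp [hPoly, geomSeries, PowerSeries.coeff_one]

theorem hPoly_singleton (k : ℕ) (i : Fin N) : hPoly k {i} = MvPolynomial.X i ^ k := by
  simp [hPoly, geomSeries, PowerSeries.coeff_succ_X_mul]

theorem hPoly_zero {Q : Finset (Fin N)} (hQ : 2 ≤ Q.card) : hPoly 0 Q = 0 := by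
  have h : (PowerSeries.X : PowerSeries (MvPolynomial (Fin N) ℂ)) ^ 2 ∣ geomSeries Q := by
    refine (pow_dvd_pow _ hQ).trans ?_
    rw [geomSeries, Finset.prod_mul_distrib, Finset.prod_const]
    exact dvd_mul_right _ _
  exact PowerSeries.X_pow_dvd_iff.1 h 1 (by norm_num)

theorem X_mul_hPoly {Q : Finset (Fin N)} {i : Fin N} (hi : i ∈ Q) (k : ℕ) :
    MvPolynomial.X i * hPoly k Q = hPoly (k + 1) Q - hPoly k (Q.erase i) := by
  have hmk : PowerSeries.mk (fun n => (MvPolynomial.X i : MvPolynomial (Fin N) ℂ) ^ n) =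
      1 + PowerSeries.X * (PowerSeries.C (MvPolynomial.X i) *
        PowerSeries.mk fun n => (MvPolynomial.X i : MvPolynomial (Fin N) ℂ) ^ n) := by
    ext1 n
    cases n with
    | zero => simp
    | succ n => simp [PowerSeries.coeff_succ_X_mul, PowerSeries.coeff_one, pow_succ']
  have h : geomSeries Q = PowerSeries.X * geomSeries (Q.erase i) +
      PowerSeries.X * (PowerSeries.C (MvPolynomial.X i) * geomSeries Q) := by
    rw [geomSeries, ← Finset.mul_prod_erase _ _ hi, ← geomSeries]
    conv_lhs => rw [hmk]
    ring
  have h2 := congrArg (PowerSeries.coeff (k + 2)) h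
  rw [map_add, PowerSeries.coeff_succ_X_mul, PowerSeries.coeff_succ_X_mul,
    PowerSeries.coeff_C_mul] at h2
  simp only [hPoly]
  rw [show k + 1 + 1 = k + 2 from rfl, h2]
  ring

end Symbols

section PartialFractions

open Lagrange

variable {K ι : Type*} [Field K] [DecidableEq ι]

theorem prod_inv_sub_eq_sum {S : Finset ι} {v : ι → K} {x : K} (hv : Set.InjOn v S)
    (hx : ∀ j ∈ S, x ≠ v j) (hS : S.Nonempty) :
    ∏ j ∈ S, (x - v j)⁻¹ = ∑ j ∈ S, nodalWeight S v j * (x - v j)⁻¹ := by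
  have h := eval_interpolate_not_at_node (s := S) (v := v) 1 hx
  rw [interpolate_one hv hS, Polynomial.eval_one, eval_nodal] at h
  have h0 : ∏ j ∈ S, (x - v j) ≠ 0 :=
    Finset.prod_ne_zero_iff.2 fun j hj => sub_ne_zero.2 (hx j hj)
  rw [Finset.prod_inv_distrib, inv_eq_iff_eq_inv]
  exact eq_inv_of_mul_eq_one_left (by simpa using h.symm)

theorem nodalWeight_erase {Q : Finset ι} {v : ι → K} {i j : ι} (hi : i ∈ Q) (hij : i ≠ j) :
    nodalWeight Q v j = nodalWeight (Q.erase i) v j * (v j - v i)⁻¹ := by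
  rw [nodalWeight, nodalWeight, Finset.erase_right_comm, Finset.prod_erase_mul]
  exact Finset.mem_erase.2 ⟨hij, hi⟩

theorem sum_nodalWeight_mul_inv {Q : Finset ι} {v : ι → K} {i : ι} (hv : Function.Injective v)
    (hi : i ∉ Q) (hQ : Q.Nonempty) :
    ∑ j ∈ Q, nodalWeight Q v j * (v i - v j)⁻¹ = nodalWeight (insert i Q) v i := by
  rw [← prod_inv_sub_eq_sum hv.injOn (fun j hj h => hi (by rwa [hv h])) hQ, nodalWeight,
    Finset.erase_insert hi]

theorem sum_nodalWeight_eq_zero {Q : Finset ι} {v : ι → K} (hv : Function.Injective v)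
    (hQ : 2 ≤ Q.card) : ∑ j ∈ Q, nodalWeight Q v j = 0 := by
  obtain ⟨i, hi⟩ : Q.Nonempty := Finset.card_pos.1 (by omega)
  have hne : (Q.erase i).Nonempty := by
    rw [← Finset.card_pos, Finset.card_erase_of_mem hi]; omega
  have h := sum_nodalWeight_mul_inv hv (Finset.notMem_erase i Q) hne
  rw [Finset.insert_erase hi] at h
  rw [← Finset.add_sum_erase _ _ hi, ← h, ← Finset.sum_add_distrib]
  refine Finset.sum_eq_zero fun j hj => ?_
  have hji := (Finset.mem_erase.1 hj).1
  rw [nodalWeight_erase hi hji.symm, ← neg_sub (v i) (v j), inv_neg]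
  ring

theorem hasDerivAt_nodalWeight {N : ℕ} {Q : Finset (Fin N)} {a : Fin N → ℝ} {i : Fin N}
    (ha : Function.Injective a) (hi : i ∈ Q) :
    HasDerivAt (fun y : ℝ => nodalWeight Q (fun j => (Function.update a i y j : ℂ)) i)
      (∑ j ∈ Q.erase i, nodalWeight Q (fun j => (a j : ℂ)) j * ((a i : ℂ) - a j)⁻¹) (a i) := by
  have hinj : Function.Injective fun j => (a j : ℂ) := Complex.ofReal_injective.comp ha
  have hcongr : ∀ y : ℝ, nodalWeight Q (fun j => (Function.update a i y j : ℂ)) i =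
      ∏ j ∈ Q.erase i, ((y : ℂ) - a j)⁻¹ := fun y => by
    rw [nodalWeight]
    refine Finset.prod_congr rfl fun j hj => ?_
    rw [Function.update_self, Function.update_of_ne (Finset.mem_erase.1 hj).1]
  simp_rw [hcongr]
  rcases (Q.erase i).eq_empty_or_nonempty with h | hne
  · simpa [h] using hasDerivAt_const (a i) (1 : ℂ)
  have hev : ∀ᶠ y : ℝ in nhds (a i), ∀ j ∈ Q.erase i, (y : ℂ) ≠ a j := by
    rw [Filter.eventually_all_finset]
    intro j hj
    have : a i ≠ a j := fun h => (Finset.mem_erase.1 hj).1 (ha h).symm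
    filter_upwards [isOpen_ne.mem_nhds this] with y hy
    exact_mod_cast hy
  have heq : (fun y : ℝ => ∏ j ∈ Q.erase i, ((y : ℂ) - a j)⁻¹) =ᶠ[nhds (a i)]
      fun y : ℝ => ∑ j ∈ Q.erase i,
        nodalWeight (Q.erase i) (fun j => (a j : ℂ)) j * ((y : ℂ) - a j)⁻¹ := by
    filter_upwards [hev] with y hy
    exact prod_inv_sub_eq_sum hinj.injOn hy hne
  refine HasDerivAt.congr_of_eventuallyEq ?_ heq
  refine HasDerivAt.fun_sum fun j hj => ?_
  have hji := (Finset.mem_erase.1 hj).1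
  have hne0 : (a i : ℂ) - a j ≠ 0 := sub_ne_zero.2 fun h => hji (hinj h).symm
  have h1 : HasDerivAt (fun y : ℝ => (y : ℂ) - a j) 1 (a i) :=
    (Complex.ofRealCLM.hasDerivAt (x := a i)).sub_const _
  convert! (h1.inv hne0).const_mul _ using 1
  rw [nodalWeight_erase hi hji.symm, ← neg_sub (a i : ℂ) (a j : ℂ), inv_neg]
  field_simp

end PartialFractions

section SmoothFunctions

variable (N : ℕ)

/-- Smooth complex-valued functions on `ℝ^N`. -/
noncomputable def smoothFun : Submodule ℂ ((Fin N → ℝ) → ℂ) where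
  carrier := {f | ContDiff ℝ (↑(⊤ : ℕ∞)) f}
  add_mem' {f g} hf hg := by
    rw [Set.mem_ofPred_eq] at hf hg ⊢
    exact hf.add hg
  zero_mem' := by
    rw [Set.mem_ofPred_eq]
    exact contDiff_zero_fun
  smul_mem' c f hf := by
    rw [Set.mem_ofPred_eq] at hf ⊢
    exact hf.const_smul c

variable {N}

theorem mem_smoothFun {f : (Fin N → ℝ) → ℂ} :
    f ∈ smoothFun N ↔ ContDiff ℝ (↑(⊤ : ℕ∞)) f := Iff.rfl

theorem contDiff_smoothFun (f : smoothFun N) : ContDiff ℝ (↑(⊤ : ℕ∞)) (f : (Fin N → ℝ) → ℂ) :=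
  mem_smoothFun.1 f.2

theorem differentiable_smoothFun (f : smoothFun N) : Differentiable ℝ (f : (Fin N → ℝ) → ℂ) :=
  (contDiff_smoothFun f).differentiable (by simp)

/-- The partial derivative in the `i`-th coordinate. -/
noncomputable def pd (i : Fin N) : Module.End ℂ (smoothFun N) where
  toFun f := ⟨fun x => fderiv ℝ (f : (Fin N → ℝ) → ℂ) x (Pi.single i 1), mem_smoothFun.2 <|
    (contDiff_infty_iff_fderiv.1 (contDiff_smoothFun f)).2.clm_apply contDiff_const⟩
  map_add' f g := by
    ext x
    simp [fderiv_add (differentiable_smoothFun f x) (differentiable_smoothFun g x)]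
  map_smul' c f := by
    ext x
    simp [fderiv_const_smul (differentiable_smoothFun f x) c]

theorem pd_comm (i j : Fin N) : pd i * pd j = pd j * pd i := by
  ext f x
  have key : ∀ i j : Fin N, ((pd i * pd j) f : (Fin N → ℝ) → ℂ) x =
      fderiv ℝ (fderiv ℝ (f : (Fin N → ℝ) → ℂ)) x (Pi.single i 1) (Pi.single j 1) := fun i j => by
    have hd : DifferentiableAt ℝ (fderiv ℝ (f : (Fin N → ℝ) → ℂ)) x :=
      ((contDiff_infty_iff_fderiv.1 (contDiff_smoothFun f)).2.differentiable (by simp)) x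
    change fderiv ℝ (fun y => fderiv ℝ (f : (Fin N → ℝ) → ℂ) y (Pi.single j 1)) x
      (Pi.single i 1) = _
    rw [fderiv_clm_apply hd (differentiableAt_const _)]
    simp
  rw [key, key]
  exact ((contDiff_smoothFun f).contDiffAt.isSymmSndFDerivAt (by
    rw [minSmoothness_of_isRCLikeNormedField]
    exact WithTop.coe_le_coe.2 (le_top : (2 : ℕ∞) ≤ ⊤))).eq _ _

theorem hasDerivAt_pd (i : Fin N) (f : smoothFun N) (x : Fin N → ℝ) :
    HasDerivAt (fun y => (f : (Fin N → ℝ) → ℂ) (Function.update x i y))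
      ((pd i f : (Fin N → ℝ) → ℂ) x) (x i) := by
  have h1 : HasFDerivAt (f : (Fin N → ℝ) → ℂ) (fderiv ℝ f x) (Function.update x i (x i)) := by
    rw [Function.update_eq_self]
    exact (differentiable_smoothFun f x).hasFDerivAt
  exact h1.comp_hasDerivAt (x i) (hasDerivAt_update x i (x i))

end SmoothFunctions

section CommutingEvaluation

variable {R σ A : Type*} [CommRing R] [Ring A] [Algebra R A]

open scoped IsMulCommutative in
/-- Evaluation of multivariate polynomials at a commuting family in an algebra. -/
noncomputable def aevalOfCommute (f : σ → A) (hf : ∀ i j, f i * f j = f j * f i) :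
    MvPolynomial σ R →ₐ[R] A :=
  letI : IsMulCommutative (Algebra.adjoin R (Set.range f)) :=
    Algebra.isMulCommutative_adjoin R (by
      rintro _ ⟨i, rfl⟩ _ ⟨j, rfl⟩
      exact hf i j)
  (Algebra.adjoin R (Set.range f)).val.comp
    (MvPolynomial.aeval fun i => ⟨f i, Algebra.subset_adjoin ⟨i, rfl⟩⟩)

theorem aevalOfCommute_X (f : σ → A) (hf : ∀ i j, f i * f j = f j * f i) (i : σ) :
    aevalOfCommute (R := R) f hf (MvPolynomial.X i) = f i := by
  simp [aevalOfCommute]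

end CommutingEvaluation

section SmoothFunctions

variable {N : ℕ}

/-- Constant coefficient differential operators. -/
noncomputable def diffOp : MvPolynomial (Fin N) ℂ →ₐ[ℂ] Module.End ℂ (smoothFun N) :=
  aevalOfCommute pd pd_comm

theorem diffOp_X (i : Fin N) : diffOp (MvPolynomial.X i) = pd i :=
  aevalOfCommute_X _ _ i

end SmoothFunctions

section Recursion

open Lagrange

variable {N : ℕ}

/-- The explicit solution of the recursion in `hasDerivAt_dressed`. -/
noncomputable def dressed (ψ : smoothFun N) (k : ℕ) (i : Fin N) (a : Fin N → ℝ) : ℂ :=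
  ∑ Q : Finset (Fin N) with i ∈ Q, (-1) ^ (Q.card + 1) * nodalWeight Q (fun j => (a j : ℂ)) i *
    (diffOp (hPoly k Q) ψ : (Fin N → ℝ) → ℂ) a

theorem dressed_zero (ψ : smoothFun N) (i : Fin N) (a : Fin N → ℝ) :
    dressed ψ 0 i a = (ψ : (Fin N → ℝ) → ℂ) a := by
  rw [dressed, Finset.sum_eq_single {i}]
  · simp [hPoly_singleton, nodalWeight]
  · intro Q hQ hne
    have hcard : 2 ≤ Q.card := by
      rw [Nat.succ_le_iff, Finset.one_lt_card_iff_nontrivial]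
      exact (Finset.nontrivial_iff_ne_singleton (Finset.mem_filter.1 hQ).2).2 hne
    simp [hPoly_zero hcard]
  · simp

theorem sum_dressed (ψ : smoothFun N) (k : ℕ) {a : Fin N → ℝ} (ha : Function.Injective a) :
    ∑ i, dressed ψ k i a =
      (diffOp (MvPolynomial.psum (Fin N) ℂ k) ψ : (Fin N → ℝ) → ℂ) a := by
  have hinj : Function.Injective fun j => (a j : ℂ) := Complex.ofReal_injective.comp ha
  have h1 : ∑ i, dressed ψ k i a = ∑ Q : Finset (Fin N), (-1) ^ (Q.card + 1) *
      (∑ i ∈ Q, nodalWeight Q (fun j => (a j : ℂ)) i) *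
        (diffOp (hPoly k Q) ψ : (Fin N → ℝ) → ℂ) a := by
    simp only [dressed]
    rw [Finset.sum_comm' (t' := Finset.univ) (s' := fun Q => Q) (by simp)]
    refine Finset.sum_congr rfl fun Q _ => ?_
    rw [Finset.mul_sum, Finset.sum_mul]
  have h2 : ∀ Q : Finset (Fin N), Q ∉ Finset.univ.map ⟨fun i : Fin N => ({i} : Finset (Fin N)),
      Finset.singleton_injective⟩ → (-1) ^ (Q.card + 1) *
      (∑ i ∈ Q, nodalWeight Q (fun j => (a j : ℂ)) i) *
        (diffOp (hPoly k Q) ψ : (Fin N → ℝ) → ℂ) a = 0 := by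
    intro Q hQ
    rcases Nat.lt_or_ge Q.card 2 with h | h
    · interval_cases hc : Q.card
      · rw [Finset.card_eq_zero.1 hc]; simp
      · obtain ⟨i, rfl⟩ := Finset.card_eq_one.1 hc
        simp at hQ
    · rw [sum_nodalWeight_eq_zero hinj h]; simp
  rw [h1, ← Finset.sum_subset (Finset.subset_univ _) fun Q _ hQ => h2 Q hQ, Finset.sum_map]
  simp [hPoly_singleton, nodalWeight, MvPolynomial.psum]

theorem hasDerivAt_dressed (ψ : smoothFun N) (k : ℕ) (i : Fin N) {a : Fin N → ℝ}
    (ha : Function.Injective a) :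
    HasDerivAt (fun y => dressed ψ k i (Function.update a i y))
      (dressed ψ (k + 1) i a +
        ∑ j ∈ Finset.univ.erase i, dressed ψ k j a * ((a i : ℂ) - a j)⁻¹) (a i) := by
  have hinj : Function.Injective fun j => (a j : ℂ) := Complex.ofReal_injective.comp ha
  set η : ℕ → Finset (Fin N) → ℂ := fun k Q => (diffOp (hPoly k Q) ψ : (Fin N → ℝ) → ℂ) a with hη
  set c : Finset (Fin N) → Fin N → ℂ := fun Q => nodalWeight Q (fun j => (a j : ℂ)) with hc
  have hη_empty : ∀ k, η k ∅ = 0 := fun k => by simp [hη, hPoly_empty]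
  have hder : HasDerivAt (fun y => dressed ψ k i (Function.update a i y))
      (∑ Q : Finset (Fin N) with i ∈ Q,
        ((-1) ^ (Q.card + 1) * (∑ j ∈ Q.erase i, c Q j * ((a i : ℂ) - a j)⁻¹) * η k Q +
          (-1) ^ (Q.card + 1) * c Q i * (η (k + 1) Q - η k (Q.erase i)))) (a i) := by
    refine HasDerivAt.fun_sum fun Q hQ => ?_
    have hi := (Finset.mem_filter.1 hQ).2
    have h1 := (hasDerivAt_nodalWeight ha hi).const_mul ((-1 : ℂ) ^ (Q.card + 1))
    have h2 := hasDerivAt_pd i (diffOp (hPoly k Q) ψ) a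
    have h3 : (pd i (diffOp (hPoly k Q) ψ) : (Fin N → ℝ) → ℂ) a =
        η (k + 1) Q - η k (Q.erase i) := by
      rw [← diffOp_X, ← Module.End.mul_apply, ← map_mul, X_mul_hPoly hi]
      simp [hη]
    rw [h3] at h2
    convert! h1.mul h2 using 1
    simp [hη, hc]
  convert! hder using 1
  have hswap : ∑ j ∈ Finset.univ.erase i, dressed ψ k j a * ((a i : ℂ) - a j)⁻¹ =
      ∑ Q : Finset (Fin N), (-1) ^ (Q.card + 1) *
        (∑ j ∈ Q.erase i, c Q j * ((a i : ℂ) - a j)⁻¹) * η k Q := by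
    simp only [dressed, Finset.sum_mul]
    rw [Finset.sum_comm' (t' := Finset.univ) (s' := fun Q => Q.erase i) (by simp)]
    refine Finset.sum_congr rfl fun Q _ => ?_
    rw [Finset.mul_sum, Finset.sum_mul]
    exact Finset.sum_congr rfl fun j _ => by simp only [hη, hc]; ring
  have hnot : ∑ Q : Finset (Fin N) with i ∉ Q, (-1) ^ (Q.card + 1) *
        (∑ j ∈ Q.erase i, c Q j * ((a i : ℂ) - a j)⁻¹) * η k Q =
      -∑ Q : Finset (Fin N) with i ∈ Q, (-1) ^ (Q.card + 1) * c Q i * η k (Q.erase i) := by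
    rw [← Finset.sum_neg_distrib]
    refine Finset.sum_bij' (fun Q _ => insert i Q) (fun Q _ => Q.erase i) (by simp) (by simp)
      (fun Q hQ => Finset.erase_insert (Finset.mem_filter.1 hQ).2)
      (fun Q hQ => Finset.insert_erase (Finset.mem_filter.1 hQ).2) fun Q hQ => ?_
    have hi := (Finset.mem_filter.1 hQ).2
    rw [Finset.erase_insert hi, Finset.card_insert_of_notMem hi, Finset.erase_eq_of_notMem hi]
    rcases Q.eq_empty_or_nonempty with rfl | hne
    · simp [hη_empty]
    · rw [sum_nodalWeight_mul_inv hinj hi hne]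
      ring
  rw [hswap, ← Finset.sum_filter_add_sum_filter_not _ (fun Q => i ∈ Q), hnot, dressed,
    Finset.sum_add_distrib]
  simp only [mul_sub, Finset.sum_sub_distrib]
  ring

theorem eq_dressed (ψ : smoothFun N) (w : ℕ → Fin N → (Fin N → ℝ) → ℂ)
    (h0 : ∀ i a, w 0 i a = (ψ : (Fin N → ℝ) → ℂ) a)
    (hrec : ∀ k i a, Function.Injective a → HasDerivAt (fun y => w k i (Function.update a i y))
      (w (k + 1) i a + ∑ j ∈ Finset.univ.erase i, w k j a * ((a i : ℂ) - a j)⁻¹) (a i))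
    (k : ℕ) : ∀ i a, Function.Injective a → w k i a = dressed ψ k i a := by
  induction k with
  | zero => exact fun i a _ => by rw [h0, dressed_zero]
  | succ k ih =>
    intro i a ha
    have hev : (fun y => w k i (Function.update a i y)) =ᶠ[nhds (a i)]
        fun y => dressed ψ k i (Function.update a i y) := by
      have : ∀ᶠ y in nhds (a i), ∀ j, j ≠ i → y ≠ a j := by
        rw [Filter.eventually_all]
        intro j
        by_cases hj : j = i
        · simp [hj]
        · filter_upwards [isOpen_ne.mem_nhds (fun h : a i = a j => hj (ha h).symm)] with y hy _
          exact hy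
      filter_upwards [this] with y hy
      refine ih i _ ?_
      intro p q hpq
      by_cases hp : p = i <;> by_cases hq : q = i
      · rw [hp, hq]
      · subst hp; simp [Function.update_of_ne hq] at hpq; exact absurd hpq (hy q hq)
      · subst hq; simp [Function.update_of_ne hp] at hpq; exact absurd hpq.symm (hy p hp)
      · simp [Function.update_of_ne hp, Function.update_of_ne hq] at hpq; exact ha hpq
    have h := (hrec k i a ha).unique ((hasDerivAt_dressed ψ k i ha).congr_of_eventuallyEq hev)
    have hsum : ∑ j ∈ Finset.univ.erase i, w k j a * ((a i : ℂ) - a j)⁻¹ =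
        ∑ j ∈ Finset.univ.erase i, dressed ψ k j a * ((a i : ℂ) - a j)⁻¹ :=
      Finset.sum_congr rfl fun j _ => by rw [ih j a ha]
    rw [hsum] at h
    exact add_right_cancel h

end Recursion

section ParametricIntegrals

variable {X : Type*} [TopologicalSpace X] [CompactSpace X] [MeasurableSpace X] [BorelSpace X]
  {μ : Measure X} [IsFiniteMeasure μ]

theorem integrable_of_continuous_compactSpace {E : Type*} [NormedAddCommGroup E] {f : X → E}
    (hf : Continuous f) : Integrable f μ :=
  hf.integrable_of_hasCompactSupport (HasCompactSupport.of_compactSpace f)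

variable [SecondCountableTopology X]

theorem hasFDerivAt_integral_of_compactSpace {H E : Type*} [NormedAddCommGroup H]
    [NormedSpace ℝ H] [ProperSpace H] [NormedAddCommGroup E] [NormedSpace ℝ E]
    {F : H → X → E} {F' : H → X → H →L[ℝ] E} (hF : ∀ a, Continuous (F a))
    (hF' : Continuous (Function.uncurry F'))
    (h : ∀ a x, HasFDerivAt (fun a => F a x) (F' a x) a) (a : H) :
    HasFDerivAt (fun a => ∫ x, F a x ∂μ) (∫ x, F' a x ∂μ) a := by
  obtain ⟨C, hC⟩ := ((isCompact_closedBall a 1).prod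
    (isCompact_univ (X := X))).exists_bound_of_continuousOn
    hF'.continuousOn
  exact hasFDerivAt_integral_of_dominated_of_fderiv_le (bound := fun _ => C)
    (Metric.closedBall_mem_nhds a one_pos)
    (Filter.Eventually.of_forall fun a => (hF a).aestronglyMeasurable)
    (integrable_of_continuous_compactSpace (hF a))
    (hF'.comp (Continuous.prodMk_right a)).aestronglyMeasurable
    (Filter.Eventually.of_forall fun x b hb => hC (b, x) ⟨hb, Set.mem_univ x⟩)
    (integrable_const C) (Filter.Eventually.of_forall fun x b _ => h b x)

theorem hasDerivAt_integral_of_compactSpace {E : Type*} [NormedAddCommGroup E] [NormedSpace ℝ E]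
    {F F' : ℝ → X → E} (hF : ∀ a, Continuous (F a)) (hF' : Continuous (Function.uncurry F'))
    (h : ∀ a x, HasDerivAt (fun a => F a x) (F' a x) a) (a : ℝ) :
    HasDerivAt (fun a => ∫ x, F a x ∂μ) (∫ x, F' a x ∂μ) a := by
  obtain ⟨C, hC⟩ := ((isCompact_closedBall a 1).prod
    (isCompact_univ (X := X))).exists_bound_of_continuousOn
    hF'.continuousOn
  exact (hasDerivAt_integral_of_dominated_loc_of_deriv_le (bound := fun _ => C)
    (Metric.closedBall_mem_nhds a one_pos)
    (Filter.Eventually.of_forall fun a => (hF a).aestronglyMeasurable)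
    (integrable_of_continuous_compactSpace (hF a))
    (hF'.comp (Continuous.prodMk_right a)).aestronglyMeasurable
    (Filter.Eventually.of_forall fun x b hb => hC (b, x) ⟨hb, Set.mem_univ x⟩)
    (integrable_const C) (Filter.Eventually.of_forall fun x b _ => h b x)).2

variable {N : ℕ} (μ) in
/-- The multivariate Laplace transform of the density `g` with respect to the functions `h`. -/
noncomputable def laplaceInt (h : Fin N → X → ℂ) (g : X → ℂ) (a : Fin N → ℝ) : ℂ :=
  ∫ x, g x * Complex.exp (∑ i, (a i : ℂ) * h i x) ∂μ

variable {N : ℕ} {h : Fin N → X → ℂ}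

theorem hasFDerivAt_laplaceInt (hh : ∀ i, Continuous (h i)) {g : X → ℂ} (hg : Continuous g)
    (a : Fin N → ℝ) :
    HasFDerivAt (laplaceInt μ h g) (∑ i, laplaceInt μ h (fun x => h i x * g x) a •
      (Complex.ofRealCLM.comp
        (ContinuousLinearMap.proj (R := ℝ) (φ := fun _ : Fin N => ℝ) i))) a := by
  have key := hasFDerivAt_integral_of_compactSpace (μ := μ)
    (F := fun (a : Fin N → ℝ) x => g x * Complex.exp (∑ i, (a i : ℂ) * h i x))
    (F' := fun a x => ∑ i, (h i x * g x * Complex.exp (∑ i, (a i : ℂ) * h i x)) •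
      (Complex.ofRealCLM.comp (ContinuousLinearMap.proj (R := ℝ) (φ := fun _ : Fin N => ℝ) i)))
    (fun a => by fun_prop) (by fun_prop) (fun a x => by
      have h1 : ∀ i, HasFDerivAt (fun a : Fin N → ℝ => (a i : ℂ)) (Complex.ofRealCLM.comp
          (ContinuousLinearMap.proj (R := ℝ) (φ := fun _ : Fin N => ℝ) i)) a := fun i =>
        (Complex.ofRealCLM.comp
          (ContinuousLinearMap.proj (R := ℝ) (φ := fun _ : Fin N => ℝ) i)).hasFDerivAt
      have h2 := ((HasFDerivAt.fun_sum (u := Finset.univ) fun i _ =>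
        (h1 i).mul_const (h i x)).cexp).const_mul (g x)
      convert! h2 using 1
      rw [Finset.smul_sum, Finset.smul_sum]
      refine Finset.sum_congr rfl fun i _ => ?_
      rw [smul_smul, smul_smul]
      congr 1
      ring) a
  convert! key using 1
  rw [integral_finsetSum]
  · exact Finset.sum_congr rfl fun i _ => by rw [integral_smul_const, laplaceInt]
  · exact fun i _ => integrable_of_continuous_compactSpace (by fun_prop)

theorem contDiff_laplaceInt (hh : ∀ i, Continuous (h i)) {g : X → ℂ} (hg : Continuous g) :
    ContDiff ℝ (↑(⊤ : ℕ∞)) (laplaceInt μ h g) := by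
  rw [contDiff_infty]
  intro n
  induction n generalizing g with
  | zero =>
    rw [Nat.cast_zero, contDiff_zero]
    exact continuous_iff_continuousAt.2 fun a => (hasFDerivAt_laplaceInt hh hg a).continuousAt
  | succ n ih =>
    rw [Nat.cast_succ, contDiff_succ_iff_hasFDerivAt]
    refine ⟨_, ?_, fun a => hasFDerivAt_laplaceInt hh hg a⟩
    exact ContDiff.sum fun i _ => (ih ((hh i).mul hg)).smul contDiff_const

theorem hasDerivAt_laplaceInt (hh : ∀ i, Continuous (h i)) {g : X → ℂ} (hg : Continuous g)
    (a : Fin N → ℝ) (i : Fin N) :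
    HasDerivAt (fun y => laplaceInt μ h g (Function.update a i y))
      (laplaceInt μ h (fun x => h i x * g x) a) (a i) := by
  have h1 := hasFDerivAt_laplaceInt (μ := μ) hh hg a
  rw [← Function.update_eq_self i a] at h1
  have h2 := h1.comp_hasDerivAt (a i) (hasDerivAt_update a i (a i))
  simpa [Pi.single_apply, Function.comp_def, apply_ite Complex.ofReal] using h2

end ParametricIntegrals

section UnitaryGroup

variable {N : ℕ}

instance compactSpace_unitaryGroup : CompactSpace (Matrix.unitaryGroup (Fin N) ℂ) := by
  have hK : IsCompact (Set.pi Set.univ fun _ : Fin N => Set.pi Set.univ fun _ : Fin N =>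
      Metric.closedBall (0 : ℂ) 1) :=
    isCompact_univ_pi fun _ => isCompact_univ_pi fun _ => isCompact_closedBall 0 1
  refine isCompact_iff_compactSpace.1 (hK.of_isClosed_subset
    (isClosed_unitary (R := Matrix (Fin N) (Fin N) ℂ)) ?_)
  intro U hU i _ j _
  exact mem_closedBall_zero_iff.2 (entry_norm_bound_of_unitary hU i j)

instance secondCountableTopology_unitaryGroup :
    SecondCountableTopology (Matrix.unitaryGroup (Fin N) ℂ) :=
  have : SecondCountableTopology (Matrix (Fin N) (Fin N) ℂ) :=
    inferInstanceAs (SecondCountableTopology (Fin N → Fin N → ℂ))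
  TopologicalSpace.Subtype.secondCountableTopology _

/-- The one-parameter unitary group generated by a skew-Hermitian matrix. -/
noncomputable def unitaryExp (X : Matrix (Fin N) (Fin N) ℂ) (hX : Xᴴ = -X) (s : ℝ) :
    Matrix.unitaryGroup (Fin N) ℂ :=
  ⟨NormedSpace.exp (s • X), by
    have h1 : star (NormedSpace.exp (s • X)) = NormedSpace.exp (-(s • X)) := by
      rw [star_eq_conjTranspose, ← exp_conjTranspose, conjTranspose_smul, hX]
      simp
    have h2 : ∀ Y : Matrix (Fin N) (Fin N) ℂ,
        NormedSpace.exp (-Y) * NormedSpace.exp Y = 1 := fun Y => by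
      rw [← exp_add_of_commute _ _ (Commute.refl Y).neg_left, neg_add_cancel, NormedSpace.exp_zero]
    rw [Unitary.mem_iff, h1]
    exact ⟨h2 _, by simpa using h2 (-(s • X))⟩⟩

theorem unitaryExp_add (X : Matrix (Fin N) (Fin N) ℂ) (hX : Xᴴ = -X) (s r : ℝ) :
    unitaryExp X hX (s + r) = unitaryExp X hX s * unitaryExp X hX r := by
  ext1
  have : Commute (s • X) (r • X) := ((Commute.refl X).smul_left s).smul_right r
  simp only [unitaryExp, Submonoid.coe_mul]
  rw [add_smul, exp_add_of_commute _ _ this]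

theorem unitaryExp_zero (X : Matrix (Fin N) (Fin N) ℂ) (hX : Xᴴ = -X) :
    unitaryExp X hX 0 = 1 := by
  ext1
  simp [unitaryExp]

open scoped Matrix.Norms.Operator in
theorem continuous_unitaryExp (X : Matrix (Fin N) (Fin N) ℂ) (hX : Xᴴ = -X) :
    Continuous (unitaryExp X hX) := by
  refine Continuous.subtype_mk ?_ _
  exact continuous_iff_continuousAt.2 fun s => (hasDerivAt_exp_smul_const X s).continuousAt

open scoped Matrix.Norms.Operator in
theorem hasDerivAt_unitaryExp_conj (X : Matrix (Fin N) (Fin N) ℂ) (hX : Xᴴ = -X)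
    (K : Matrix (Fin N) (Fin N) ℂ) (i j : Fin N) :
    HasDerivAt (fun s => ((unitaryExp X hX s : Matrix (Fin N) (Fin N) ℂ) * K *
      star (unitaryExp X hX s : Matrix (Fin N) (Fin N) ℂ)) i j) ((X * K - K * X) i j) 0 := by
  have h1 := hasDerivAt_exp_smul_const X (0 : ℝ)
  have h2 := hasDerivAt_exp_smul_const (-X) (0 : ℝ)
  have h3 : ∀ s, star (unitaryExp X hX s : Matrix (Fin N) (Fin N) ℂ) =
      NormedSpace.exp (s • -X) := fun s => by
    rw [unitaryExp, star_eq_conjTranspose, ← exp_conjTranspose, conjTranspose_smul, hX]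
    simp
  simp only [h3]
  have h4 := (h1.mul_const K).mul h2
  have h5 := hasDerivAt_pi.1 (hasDerivAt_pi.1 h4 i) j
  have h6 : (X * K - K * X) i j = (NormedSpace.exp ((0 : ℝ) • X) * X * K *
      NormedSpace.exp ((0 : ℝ) • -X) + NormedSpace.exp ((0 : ℝ) • X) * K *
        (NormedSpace.exp ((0 : ℝ) • -X) * -X)) i j := by
    simp [sub_eq_add_neg]
  rw [h6]
  exact h5

theorem integral_eq_zero_of_hasDerivAt_unitaryExp {μ : Measure (Matrix.unitaryGroup (Fin N) ℂ)}
    [IsFiniteMeasure μ] [μ.IsMulLeftInvariant] {f g : Matrix.unitaryGroup (Fin N) ℂ → ℂ}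
    (hf : Continuous f) (hg : Continuous g) (X : Matrix (Fin N) (Fin N) ℂ) (hX : Xᴴ = -X)
    (h : ∀ U, HasDerivAt (fun s => f (unitaryExp X hX s * U)) (g U) 0) :
    ∫ U, g U ∂μ = 0 := by
  have hc := continuous_unitaryExp X hX
  have hder := hasDerivAt_integral_of_compactSpace (μ := μ)
    (F := fun s U => f (unitaryExp X hX s * U)) (F' := fun s U => g (unitaryExp X hX s * U))
    (fun s => by fun_prop) (by fun_prop) (fun s U => by
      have h1 := h (unitaryExp X hX s * U)
      rw [← sub_self s] at h1
      have h2 := h1.comp_sub_const s s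
      simpa [← mul_assoc, ← unitaryExp_add] using h2) 0
  simp only [integral_mul_left_eq_self (fun U => f U), integral_mul_left_eq_self (fun U => g U)]
    at hder
  exact hder.unique (hasDerivAt_const _ _)

end UnitaryGroup

section VandermondeProduct

variable {N : ℕ}

/-- The product of the differences of the coordinates. -/
noncomputable def vandermondeProd (a : Fin N → ℝ) : ℂ :=
  ∏ p : Fin N × Fin N with p.1 < p.2, ((a p.2 : ℂ) - a p.1)

theorem vandermondeProd_eq_zero_iff {a : Fin N → ℝ} :
    vandermondeProd a = 0 ↔ ¬ Function.Injective a := by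
  rw [vandermondeProd, Finset.prod_eq_zero_iff, Function.not_injective_iff]
  constructor
  · rintro ⟨p, hp, h⟩
    refine ⟨p.1, p.2, ?_, (Finset.mem_filter.1 hp).2.ne⟩
    exact_mod_cast (sub_eq_zero.1 h).symm
  · rintro ⟨i, j, h, hij⟩
    rcases lt_or_gt_of_ne hij with hlt | hlt
    · exact ⟨(i, j), by simpa using hlt, by simp [h]⟩
    · exact ⟨(j, i), by simpa using hlt, by simp [h]⟩

theorem contDiff_vandermondeProd :
    ContDiff ℝ (↑(⊤ : ℕ∞)) (vandermondeProd : (Fin N → ℝ) → ℂ) := by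
  have : ∀ i : Fin N, ContDiff ℝ (↑(⊤ : ℕ∞)) fun a : Fin N → ℝ => (a i : ℂ) := fun i =>
    Complex.ofRealCLM.contDiff.comp (contDiff_apply ℝ ℝ i)
  exact contDiff_prod fun p _ => (this p.2).sub (this p.1)

theorem hasDerivAt_vandermondeProd {a : Fin N → ℝ} (ha : Function.Injective a) (i : Fin N) :
    HasDerivAt (fun y => vandermondeProd (Function.update a i y))
      (vandermondeProd a * ∑ j ∈ Finset.univ.erase i, ((a i : ℂ) - a j)⁻¹) (a i) := by
  set δ : Fin N → ℂ := Pi.single i 1 with hδ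
  have hcoord : ∀ j, HasDerivAt (fun y => ((Function.update a i y j : ℝ) : ℂ)) (δ j) (a i) :=
    fun j => by
      have h := (hasDerivAt_pi.1 (hasDerivAt_update a i (a i)) j).ofReal_comp
      convert! h using 1
      simp [hδ, Pi.single_apply, apply_ite Complex.ofReal]
  have hne : ∀ p ∈ (Finset.univ.filter fun p : Fin N × Fin N => p.1 < p.2),
      ((a p.2 : ℂ) - a p.1) ≠ 0 := fun p hp => sub_ne_zero.2 fun h =>
    (Finset.mem_filter.1 hp).2.ne' (ha (Complex.ofReal_injective h))
  have hprod := HasDerivAt.fun_finsetProd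
    (u := Finset.univ.filter fun p : Fin N × Fin N => p.1 < p.2)
    fun p _ => (hcoord p.2).sub (hcoord p.1)
  convert! hprod using 1
  simp only [Function.update_eq_self, smul_eq_mul, Pi.sub_apply]
  have h1 : ∀ p ∈ (Finset.univ.filter fun p : Fin N × Fin N => p.1 < p.2),
      (∏ q ∈ (Finset.univ.filter fun p : Fin N × Fin N => p.1 < p.2).erase p,
        ((a q.2 : ℂ) - a q.1)) * (δ p.2 - δ p.1) =
      vandermondeProd a * ((δ p.2 - δ p.1) * ((a p.2 : ℂ) - a p.1)⁻¹) := fun p hp => by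
    rw [vandermondeProd, ← Finset.prod_erase_mul _ _ hp]
    field_simp [hne p hp]
  rw [Finset.sum_congr rfl h1, ← Finset.mul_sum]
  congr 1
  rw [Finset.sum_filter, Fintype.sum_prod_type]
  have h2 : ∀ p q : Fin N, (if p < q then (δ q - δ p) * ((a q : ℂ) - a p)⁻¹ else 0) =
      (if q = i then (if p < i then ((a i : ℂ) - a p)⁻¹ else 0) else 0) +
      (if p = i then (if i < q then ((a i : ℂ) - a q)⁻¹ else 0) else 0) := fun p q => by
    have h3 : ((a i : ℂ) - a q)⁻¹ = -((a q : ℂ) - a i)⁻¹ := by rw [← inv_neg, neg_sub]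
    by_cases hp : p = i <;> by_cases hq : q = i <;> by_cases hpq : p < q <;>
      simp_all [Pi.single_apply]
  simp only [h2, Finset.sum_add_distrib, Finset.sum_ite_eq', Finset.mem_univ, if_true]
  rw [Finset.sum_comm (f := fun x y => if x = i then _ else _)]
  simp only [Finset.sum_ite_eq', Finset.mem_univ, if_true]
  rw [← Finset.sum_add_distrib]
  refine Eq.trans ?_ (Finset.sum_erase (a := i) _ (by simp))
  refine Finset.sum_congr rfl fun j hj => ?_
  rcases lt_or_gt_of_ne (Finset.ne_of_mem_erase hj) with h | h <;> simp [h, h.not_gt]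

end VandermondeProduct

section LoopEquations

variable {N : ℕ}

/-- The conjugate `U B U⁻¹`. -/
def conjMat (B : Matrix (Fin N) (Fin N) ℂ) (U : Matrix.unitaryGroup (Fin N) ℂ) :
    Matrix (Fin N) (Fin N) ℂ :=
  (U : Matrix (Fin N) (Fin N) ℂ) * B * star (U : Matrix (Fin N) (Fin N) ℂ)

theorem conjMat_mul_conjMat (B C : Matrix (Fin N) (Fin N) ℂ)
    (U : Matrix.unitaryGroup (Fin N) ℂ) : conjMat B U * conjMat C U = conjMat (B * C) U := by
  have h : star (U : Matrix (Fin N) (Fin N) ℂ) * (U : Matrix (Fin N) (Fin N) ℂ) = 1 :=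
    Unitary.coe_star_mul_self U
  calc conjMat B U * conjMat C U
      = (U : Matrix (Fin N) (Fin N) ℂ) * B * (star (U : Matrix (Fin N) (Fin N) ℂ) * U) * C *
        star (U : Matrix (Fin N) (Fin N) ℂ) := by simp only [conjMat, mul_assoc]
    _ = conjMat (B * C) U := by rw [h]; simp only [conjMat, mul_one, mul_assoc]

theorem conjMat_mul (B : Matrix (Fin N) (Fin N) ℂ) (V U : Matrix.unitaryGroup (Fin N) ℂ) :
    conjMat B (V * U) = (V : Matrix (Fin N) (Fin N) ℂ) * conjMat B U *
      star (V : Matrix (Fin N) (Fin N) ℂ) := by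
  simp only [conjMat, Submonoid.coe_mul, star_mul, mul_assoc]

theorem conjMat_one (U : Matrix.unitaryGroup (Fin N) ℂ) : conjMat 1 U = 1 := by
  simp [conjMat]

theorem trace_conjMat (B : Matrix (Fin N) (Fin N) ℂ) (U : Matrix.unitaryGroup (Fin N) ℂ) :
    (conjMat B U).trace = B.trace := by
  rw [conjMat, Matrix.trace_mul_cycle, Unitary.coe_star_mul_self, one_mul]

theorem continuous_conjMat_apply (B : Matrix (Fin N) (Fin N) ℂ) (i j : Fin N) :
    Continuous fun U : Matrix.unitaryGroup (Fin N) ℂ => conjMat B U i j := by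
  have : Continuous (conjMat B) := by
    unfold conjMat
    fun_prop
  exact this.matrix_elem i j

variable (μ : Measure (Matrix.unitaryGroup (Fin N) ℂ)) [IsFiniteMeasure μ]

/-- The integral of `g` against the density `U ↦ exp (t ∑ aᵢ (U B U⁻¹)ᵢᵢ)`. -/
noncomputable def orbitInt (B : Matrix (Fin N) (Fin N) ℂ) (t : ℂ)
    (g : Matrix.unitaryGroup (Fin N) ℂ → ℂ) (a : Fin N → ℝ) : ℂ :=
  laplaceInt μ (fun i U => t * conjMat B U i i) g a

/-- The exponential moments of the diagonal entries of powers of `t U B U⁻¹`. -/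
noncomputable def loopFun (B : Matrix (Fin N) (Fin N) ℂ) (t : ℂ) (k : ℕ) (i : Fin N)
    (a : Fin N → ℝ) : ℂ :=
  orbitInt μ B t (fun U => t ^ k * conjMat (B ^ k) U i i) a

theorem sum_loopFun (B : Matrix (Fin N) (Fin N) ℂ) (t : ℂ) (k : ℕ) (a : Fin N → ℝ) :
    ∑ i, loopFun μ B t k i a = t ^ k * (B ^ k).trace * orbitInt μ B t 1 a := by
  have hcont := continuous_conjMat_apply (N := N)
  simp only [loopFun, orbitInt, laplaceInt]
  rw [← integral_finsetSum _ fun j _ => integrable_of_continuous_compactSpace (by fun_prop),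
    ← integral_const_mul]
  refine integral_congr_ae (Filter.Eventually.of_forall fun U => ?_)
  rw [← trace_conjMat (B ^ k) U]
  simp only [Matrix.trace, Matrix.diag_apply, Finset.mul_sum, Finset.sum_mul, Pi.one_apply]
  exact Finset.sum_congr rfl fun i _ => by ring

theorem contDiff_orbitInt_one (B : Matrix (Fin N) (Fin N) ℂ) (t : ℂ) :
    ContDiff ℝ (↑(⊤ : ℕ∞)) (orbitInt μ B t 1) :=
  contDiff_laplaceInt (fun i => (continuous_conjMat_apply B i i).const_mul t) continuous_one

/-- The Vandermonde product times the exponential integral over the unitary orbit of `B`. -/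
noncomputable def dressedInt (B : Matrix (Fin N) (Fin N) ℂ) (t : ℂ) : smoothFun N :=
  ⟨fun a => vandermondeProd a * orbitInt μ B t 1 a,
    mem_smoothFun.2 (contDiff_vandermondeProd.mul (contDiff_orbitInt_one μ B t))⟩

theorem dressedInt_apply (B : Matrix (Fin N) (Fin N) ℂ) (t : ℂ) (a : Fin N → ℝ) :
    (dressedInt μ B t : (Fin N → ℝ) → ℂ) a = vandermondeProd a * orbitInt μ B t 1 a := rfl

variable [μ.IsMulLeftInvariant]

theorem integral_commutator_eq_zero (B C : Matrix (Fin N) (Fin N) ℂ) (t : ℂ) (a : Fin N → ℝ)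
    (X : Matrix (Fin N) (Fin N) ℂ) (i j : Fin N) :
    orbitInt μ B t (fun U => (X * conjMat C U - conjMat C U * X) i j + conjMat C U i j *
      ∑ l, (a l : ℂ) * (t * (X * conjMat B U - conjMat B U * X) l l)) a = 0 := by
  have hcont := continuous_conjMat_apply (N := N)
  have hG : ∀ X : Matrix (Fin N) (Fin N) ℂ, Continuous fun U : Matrix.unitaryGroup (Fin N) ℂ =>
      ((X * conjMat C U - conjMat C U * X) i j + conjMat C U i j *
      ∑ l, (a l : ℂ) * (t * (X * conjMat B U - conjMat B U * X) l l)) *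
        Complex.exp (∑ l, (a l : ℂ) * (t * conjMat B U l l)) := fun X => by
    simp only [Matrix.sub_apply, Matrix.mul_apply]
    fun_prop
  have hskew : ∀ X : Matrix (Fin N) (Fin N) ℂ, Xᴴ = -X →
      orbitInt μ B t (fun U => (X * conjMat C U - conjMat C U * X) i j + conjMat C U i j *
      ∑ l, (a l : ℂ) * (t * (X * conjMat B U - conjMat B U * X) l l)) a = 0 := fun X hX => by
    refine integral_eq_zero_of_hasDerivAt_unitaryExp
      (f := fun U => conjMat C U i j * Complex.exp (∑ l, (a l : ℂ) * (t * conjMat B U l l)))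
      (by fun_prop) (hG X) X hX fun U => ?_
    have h1 := fun K => hasDerivAt_unitaryExp_conj X hX (conjMat K U)
    simp only [← conjMat_mul] at h1
    have h2 := (h1 C i j).mul (HasDerivAt.fun_sum (u := Finset.univ) fun l _ =>
      ((h1 B l l).const_mul t).const_mul (a l : ℂ)).cexp
    convert! h2 using 1
    simp only [unitaryExp_zero, one_mul]
    ring
  have hP := hskew ((1 / 2 : ℂ) • (X - Xᴴ)) (by
    rw [conjTranspose_smul, conjTranspose_sub, conjTranspose_conjTranspose, ← smul_neg, neg_sub]
    simp)
  have hQ := hskew ((-Complex.I / 2 : ℂ) • (X + Xᴴ)) (by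
    rw [conjTranspose_smul, conjTranspose_add, conjTranspose_conjTranspose, ← neg_smul,
      add_comm]
    simp [neg_div])
  have hX : X = (1 / 2 : ℂ) • (X - Xᴴ) + Complex.I • ((-Complex.I / 2 : ℂ) • (X + Xᴴ)) := by
    rw [smul_smul, show Complex.I * (-Complex.I / 2) = 1 / 2 by
      linear_combination (-1 / 2 : ℂ) * Complex.I_sq, ← smul_add]
    simp [← two_smul ℂ X, smul_smul]
  simp only [orbitInt, laplaceInt] at hP hQ ⊢
  set P := (1 / 2 : ℂ) • (X - Xᴴ)
  set Q := (-Complex.I / 2 : ℂ) • (X + Xᴴ)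
  have h3 := integral_add (μ := μ) (integrable_of_continuous_compactSpace (hG P))
    ((integrable_of_continuous_compactSpace (hG Q)).const_mul Complex.I)
  rw [integral_const_mul, hP, hQ, mul_zero, add_zero] at h3
  rw [← h3]
  refine integral_congr_ae (Filter.Eventually.of_forall fun U => ?_)
  have h4 : ∀ K : Matrix (Fin N) (Fin N) ℂ, ∀ p q, (X * K - K * X) p q =
      (P * K - K * P) p q + Complex.I * (Q * K - K * Q) p q := fun K p q => by
    have : X * K - K * X = (P * K - K * P) + Complex.I • (Q * K - K * Q) := by
      rw [hX]
      simp only [add_mul, mul_add, smul_sub, Matrix.smul_mul, Matrix.mul_smul]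
      abel
    rw [this]
    simp
  simp only [h4]
  simp only [mul_add, Finset.sum_add_distrib, add_mul]
  simp only [Finset.mul_sum, Finset.sum_mul, mul_left_comm Complex.I, mul_assoc]
  ring

theorem loopFun_sub_loopFun (B : Matrix (Fin N) (Fin N) ℂ) (t : ℂ) (k : ℕ) (i j : Fin N)
    (a : Fin N → ℝ) :
    loopFun μ B t k i a - loopFun μ B t k j a = ((a i : ℂ) - a j) *
      orbitInt μ B t (fun U => t ^ (k + 1) * (conjMat (B ^ k) U i j * conjMat B U j i)) a := by
  have hcont := continuous_conjMat_apply (N := N)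
  obtain ⟨E, hE⟩ : ∃ E : Matrix (Fin N) (Fin N) ℂ, E = Matrix.single i j 1 := ⟨_, rfl⟩
  have h := integral_commutator_eq_zero μ B (B ^ k) t a E i j
  have h1 : ∀ U, ∑ l, (a l : ℂ) * (t * (E * conjMat B U - conjMat B U * E) l l) =
      t * ((a i : ℂ) - a j) * conjMat B U j i := by
    intro U
    have h2 : ∀ l, (E * conjMat B U - conjMat B U * E) l l = (if l = i then conjMat B U j i else 0) -
        (if l = j then conjMat B U j i else 0) := fun l => by
      rw [Matrix.sub_apply, hE]
      congr 1
      · split_ifs with hl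
        · rw [hl, Matrix.single_mul_apply_same, one_mul]
        · exact Matrix.single_mul_apply_of_ne _ _ _ _ _ hl _
      · split_ifs with hl
        · rw [hl, Matrix.mul_single_apply_same, mul_one]
        · exact Matrix.mul_single_apply_of_ne _ _ _ _ _ hl _
    simp only [h2, mul_sub, Finset.sum_sub_distrib, mul_ite, mul_zero, Finset.sum_ite_eq',
      Finset.mem_univ, if_true]
    ring
  have h2 : ∀ U, (E * conjMat (B ^ k) U -
      conjMat (B ^ k) U * E) i j =
        conjMat (B ^ k) U j j - conjMat (B ^ k) U i i := fun U => by
    simp [hE, Matrix.sub_apply]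
  simp only [h1, h2] at h
  simp only [loopFun, orbitInt, laplaceInt] at h ⊢
  rw [← integral_sub (integrable_of_continuous_compactSpace (by fun_prop))
    (integrable_of_continuous_compactSpace (by fun_prop)), ← integral_const_mul, ← sub_eq_zero,
    ← integral_sub (integrable_of_continuous_compactSpace (by fun_prop))
    (integrable_of_continuous_compactSpace (by fun_prop))]
  rw [← mul_zero (-t ^ k), ← h, ← integral_const_mul]
  refine integral_congr_ae (Filter.Eventually.of_forall fun U => ?_)
  ring

theorem loopFun_succ (B : Matrix (Fin N) (Fin N) ℂ) (t : ℂ) (k : ℕ) (i : Fin N)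
    {a : Fin N → ℝ} (ha : Function.Injective a) :
    loopFun μ B t (k + 1) i a =
      orbitInt μ B t (fun U => t * conjMat B U i i * (t ^ k * conjMat (B ^ k) U i i)) a +
      ∑ j ∈ Finset.univ.erase i,
        (loopFun μ B t k i a - loopFun μ B t k j a) * ((a i : ℂ) - a j)⁻¹ := by
  have hcont := continuous_conjMat_apply (N := N)
  have h1 : ∀ j ∈ Finset.univ.erase i,
      (loopFun μ B t k i a - loopFun μ B t k j a) * ((a i : ℂ) - a j)⁻¹ =
      orbitInt μ B t (fun U => t ^ (k + 1) * (conjMat (B ^ k) U i j * conjMat B U j i)) a :=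
    fun j hj => by
      have hij := (Finset.ne_of_mem_erase hj).symm
      have hne : (a i : ℂ) - a j ≠ 0 := sub_ne_zero.2 fun h =>
        hij (ha (Complex.ofReal_injective h))
      rw [loopFun_sub_loopFun]
      field_simp
  rw [Finset.sum_congr rfl h1]
  simp only [loopFun, orbitInt, laplaceInt]
  rw [← integral_finsetSum _ fun j _ => integrable_of_continuous_compactSpace (by fun_prop),
    ← integral_add (integrable_of_continuous_compactSpace (by fun_prop))
    (integrable_of_continuous_compactSpace (by fun_prop))]
  refine integral_congr_ae (Filter.Eventually.of_forall fun U => ?_)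
  simp only [pow_succ B, ← conjMat_mul_conjMat, Matrix.mul_apply]
  rw [← Finset.add_sum_erase _ _ (Finset.mem_univ i), mul_add, add_mul, Finset.mul_sum,
    Finset.sum_mul]
  ring

theorem diffOp_psum_dressedInt_of_injective (B : Matrix (Fin N) (Fin N) ℂ) (t : ℂ) (k : ℕ)
    {a : Fin N → ℝ} (ha : Function.Injective a) :
    (diffOp (MvPolynomial.psum (Fin N) ℂ k) (dressedInt μ B t) : (Fin N → ℝ) → ℂ) a =
      t ^ k * (B ^ k).trace * (dressedInt μ B t : (Fin N → ℝ) → ℂ) a := by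
  have hcont := continuous_conjMat_apply (N := N)
  have key := eq_dressed (dressedInt μ B t)
    (fun k i a => vandermondeProd a * loopFun μ B t k i a) (fun i a => by
      simp [dressedInt_apply, loopFun, conjMat_one, Pi.one_def])
    (fun k i a ha => by
      have h1 := (hasDerivAt_vandermondeProd ha i).mul (hasDerivAt_laplaceInt (μ := μ)
        (h := fun i U => t * conjMat B U i i) (g := fun U => t ^ k * conjMat (B ^ k) U i i)
        (by fun_prop) (by fun_prop) a i)
      convert! h1 using 1
      simp only [Function.update_eq_self]
      rw [loopFun_succ μ B t k i ha]
      simp only [mul_add, sub_mul, Finset.sum_sub_distrib, ← Finset.mul_sum, mul_assoc,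
        loopFun, orbitInt]
      ring) k
  rw [← sum_dressed _ _ ha, ← Finset.sum_congr rfl fun i _ => key i a ha, ← Finset.mul_sum,
    sum_loopFun, dressedInt_apply]
  ring

theorem dense_injective : Dense {a : Fin N → ℝ | Function.Injective a} := by
  intro a
  have h1 : Filter.Tendsto (fun s : ℝ => fun i : Fin N => a i + s * (i : ℕ)) (nhdsWithin 0 {0}ᶜ)
      (nhds a) := by
    have : Continuous fun s : ℝ => fun i : Fin N => a i + s * (i : ℕ) := by fun_prop
    simpa using (this.tendsto 0).mono_left nhdsWithin_le_nhds
  refine mem_closure_of_tendsto h1 ?_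
  have h2 : ∀ i j : Fin N, ∀ᶠ s in nhdsWithin (0 : ℝ) {0}ᶜ,
      a i + s * (i : ℕ) = a j + s * (j : ℕ) → i = j := fun i j => by
    by_cases hij : i = j
    · simp [hij]
    have hne : ((i : ℕ) : ℝ) - (j : ℕ) ≠ 0 := sub_ne_zero.2 fun h =>
      hij (Fin.ext (by exact_mod_cast h))
    by_cases ha : a i = a j
    · filter_upwards [self_mem_nhdsWithin] with s hs h
      exact absurd (mul_eq_zero.1 (by linear_combination h - ha :
        s * (((i : ℕ) : ℝ) - (j : ℕ)) = 0)) (not_or.2 ⟨hs, hne⟩)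
    · have hc : ContinuousAt (fun s : ℝ => a i + s * (i : ℕ) - (a j + s * (j : ℕ))) 0 := by
        fun_prop
      filter_upwards [nhdsWithin_le_nhds (hc.eventually_ne (y := 0) (by
        simpa using sub_ne_zero.2 ha))] with s hs h
      exact absurd (sub_eq_zero.2 h) hs
  filter_upwards [Filter.eventually_all.2 fun i => Filter.eventually_all.2 fun j => h2 i j]
    with s hs i j hij
  exact hs i j hij

theorem diffOp_psum_dressedInt (B : Matrix (Fin N) (Fin N) ℂ) (t : ℂ) (k : ℕ) :
    diffOp (MvPolynomial.psum (Fin N) ℂ k) (dressedInt μ B t) =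
      (t ^ k * (B ^ k).trace) • dressedInt μ B t := by
  apply Subtype.ext
  refine Continuous.ext_on dense_injective (contDiff_smoothFun _).continuous
    (contDiff_smoothFun _).continuous fun a ha => ?_
  exact diffOp_psum_dressedInt_of_injective μ B t k ha

end LoopEquations

section Newton

variable {σ R : Type*} [Fintype σ] [CommRing R] [Algebra ℚ R]

theorem aeval_esymm_eq_of_sum_pow_eq {x y : σ → R} (h : ∀ k, ∑ i, x i ^ k = ∑ i, y i ^ k)
    (k : ℕ) : MvPolynomial.aeval x (MvPolynomial.esymm σ ℚ k) =
      MvPolynomial.aeval y (MvPolynomial.esymm σ ℚ k) := by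
  induction k using Nat.strong_induction_on with
  | _ k ih =>
    rcases Nat.eq_zero_or_pos k with rfl | hk
    · simp
    have hpsum : ∀ m, MvPolynomial.aeval x (MvPolynomial.psum σ ℚ m) =
        MvPolynomial.aeval y (MvPolynomial.psum σ ℚ m) := fun m => by
      simpa [MvPolynomial.psum] using h m
    have key : (k : ℚ) • MvPolynomial.aeval x (MvPolynomial.esymm σ ℚ k) =
        (k : ℚ) • MvPolynomial.aeval y (MvPolynomial.esymm σ ℚ k) := by
      rw [← map_smul, ← map_smul, MvPolynomial.smul_eq_C_mul, map_natCast,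
        MvPolynomial.mul_esymm_eq_sum]
      simp only [map_mul, map_sum, map_pow, map_neg, map_one]
      congr 1
      refine Finset.sum_congr rfl fun p hp => ?_
      rw [ih p.1 (Finset.mem_filter.1 hp).2, hpsum]
    have hk0 : (k : ℚ) ≠ 0 := Nat.cast_ne_zero.2 hk.ne'
    simpa [smul_smul, inv_mul_cancel₀ hk0] using congrArg (fun r => (k : ℚ)⁻¹ • r) key

theorem prod_sub_eq_zero_of_sum_pow_eq {x y : σ → R} (h : ∀ k, ∑ i, x i ^ k = ∑ i, y i ^ k)
    (i : σ) : ∏ j, (x i - y j) = 0 := by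
  have h1 : ∀ z : σ → R, ∏ j, (Polynomial.X - Polynomial.C (z j)) =
      ∑ k ∈ Finset.range (Fintype.card σ + 1), (-1) ^ k * (Polynomial.C
        (MvPolynomial.aeval z (MvPolynomial.esymm σ ℚ k)) *
          Polynomial.X ^ (Fintype.card σ - k)) := fun z => by
    have := Multiset.prod_X_sub_X_eq_sum_esymm (Finset.univ.val.map z)
    simpa [MvPolynomial.aeval_esymm_eq_multiset_esymm, Function.comp_def] using this
  have h2 : ∏ j, (Polynomial.X - Polynomial.C (y j)) = ∏ j, (Polynomial.X - Polynomial.C (x j)) := by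
    rw [h1, h1]
    simp only [aeval_esymm_eq_of_sum_pow_eq h]
  have h3 := congrArg (Polynomial.eval (x i)) h2
  simp only [Polynomial.eval_prod, Polynomial.eval_sub, Polynomial.eval_X, Polynomial.eval_C] at h3
  rw [h3]
  exact Finset.prod_eq_zero (Finset.mem_univ i) (sub_self _)

end Newton

section ConstantCoefficients

variable {N : ℕ}

/-- The constant coefficient differential operators annihilating `ψ`. -/
noncomputable def annihilatorIdeal (ψ : smoothFun N) : Ideal (MvPolynomial (Fin N) ℂ) where
  carrier := {q | diffOp q ψ = 0}
  add_mem' {p q} hp hq := by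
    rw [Set.mem_ofPred_eq] at hp hq ⊢
    rw [map_add, LinearMap.add_apply, hp, hq, add_zero]
  zero_mem' := by
    rw [Set.mem_ofPred_eq, map_zero, LinearMap.zero_apply]
  smul_mem' p q hq := by
    rw [Set.mem_ofPred_eq] at hq ⊢
    rw [smul_eq_mul, map_mul, Module.End.mul_apply, hq, map_zero]

theorem mem_annihilatorIdeal {ψ : smoothFun N} {q : MvPolynomial (Fin N) ℂ} :
    q ∈ annihilatorIdeal ψ ↔ diffOp q ψ = 0 := Iff.rfl

theorem diffOp_C (c : ℂ) (ψ : smoothFun N) : diffOp (MvPolynomial.C c) ψ = c • ψ := by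
  rw [← MvPolynomial.algebraMap_eq, AlgHom.commutes, Module.algebraMap_end_apply]

theorem diffOp_prod_X_sub_C_eq_zero {ψ : smoothFun N} {ν : Fin N → ℂ}
    (h : ∀ k, diffOp (MvPolynomial.psum (Fin N) ℂ k) ψ = (∑ j, ν j ^ k) • ψ) (i : Fin N) :
    diffOp (∏ j, (MvPolynomial.X i - MvPolynomial.C (ν j))) ψ = 0 := by
  rw [← mem_annihilatorIdeal, ← Ideal.Quotient.eq_zero_iff_mem]
  have key := prod_sub_eq_zero_of_sum_pow_eq
    (x := fun i => Ideal.Quotient.mk (annihilatorIdeal ψ) (MvPolynomial.X i))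
    (y := fun j => Ideal.Quotient.mk (annihilatorIdeal ψ) (MvPolynomial.C (ν j))) (fun k => by
      simp only [← map_pow, ← map_sum]
      rw [Ideal.Quotient.eq, mem_annihilatorIdeal, map_sub, LinearMap.sub_apply, diffOp_C,
        sub_eq_zero]
      exact h k) i
  simpa only [map_prod, map_sub] using key

theorem exists_eq_exp_of_diffOp_eq_zero {φ : smoothFun N} {i : Fin N} {ν : ℂ}
    (h : diffOp (MvPolynomial.X i - MvPolynomial.C ν) φ = 0) (a : Fin N → ℝ) :
    ∃ c : ℂ, ∀ y : ℝ, (φ : (Fin N → ℝ) → ℂ) (Function.update a i y) =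
      c * Complex.exp (ν * y) := by
  rw [map_sub, LinearMap.sub_apply, diffOp_X, diffOp_C, sub_eq_zero] at h
  set f : ℝ → ℂ := fun y => (φ : (Fin N → ℝ) → ℂ) (Function.update a i y) with hf
  have hd : ∀ y, HasDerivAt f (ν * f y) y := fun y => by
    have h1 := hasDerivAt_pd i φ (Function.update a i y)
    rw [h] at h1
    simpa using h1
  have hexp : ∀ y : ℝ, HasDerivAt (fun y : ℝ => Complex.exp (-ν * y))
      (Complex.exp (-ν * y) * -ν) y := fun y => by
    simpa using ((Complex.ofRealCLM.hasDerivAt (x := y)).const_mul (-ν)).cexp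
  have hconst : ∀ y, HasDerivAt (fun y : ℝ => f y * Complex.exp (-ν * y)) 0 y := fun y => by
    convert! (hd y).mul (hexp y) using 1
    ring
  refine ⟨f 0, fun y => ?_⟩
  have h2 := is_const_of_deriv_eq_zero (fun y => (hconst y).differentiableAt)
    (fun y => (hconst y).deriv) y 0
  simp only [Complex.ofReal_zero, mul_zero, Complex.exp_zero, mul_one, neg_mul] at h2
  rw [← h2, mul_assoc, ← Complex.exp_add, neg_add_cancel, Complex.exp_zero, mul_one]

theorem exists_eq_sum_exp_of_diffOp_eq_zero {ψ : smoothFun N} {i : Fin N} {ν : Fin N → ℂ}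
    (hν : Function.Injective ν)
    (h : diffOp (∏ j, (MvPolynomial.X i - MvPolynomial.C (ν j))) ψ = 0) (a : Fin N → ℝ) :
    ∃ c : Fin N → ℂ, ∀ y : ℝ, (ψ : (Fin N → ℝ) → ℂ) (Function.update a i y) =
      ∑ j, c j * Complex.exp (ν j * y) := by
  set L : Fin N → MvPolynomial (Fin N) ℂ := fun j =>
    Polynomial.aeval (MvPolynomial.X i) (Lagrange.basis Finset.univ ν j) with hL
  have hsum : ∑ j, L j = 1 := by
    rw [hL, ← map_sum, Lagrange.sum_basis hν.injOn ⟨i, Finset.mem_univ i⟩, map_one]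
  have hmul : ∀ j, ∃ c : ℂ, (MvPolynomial.X i - MvPolynomial.C (ν j)) * L j =
      MvPolynomial.C c * ∏ j, (MvPolynomial.X i - MvPolynomial.C (ν j)) := fun j => by
    refine ⟨∏ k ∈ Finset.univ.erase j, (ν j - ν k)⁻¹, ?_⟩
    rw [← Finset.mul_prod_erase _ _ (Finset.mem_univ j), hL]
    simp only [Lagrange.basis, Lagrange.basisDivisor, map_prod, map_mul, Polynomial.aeval_C,
      map_sub, Polynomial.aeval_X, MvPolynomial.algebraMap_eq, Finset.prod_mul_distrib]
    ring
  have hann : ∀ j, diffOp (MvPolynomial.X i - MvPolynomial.C (ν j)) (diffOp (L j) ψ) = 0 :=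
    fun j => by
      obtain ⟨c, hc⟩ := hmul j
      rw [← Module.End.mul_apply, ← map_mul, hc, map_mul, Module.End.mul_apply, h, map_zero]
  choose c hc using fun j => exists_eq_exp_of_diffOp_eq_zero (hann j) a
  refine ⟨c, fun y => ?_⟩
  have hψ : ψ = ∑ j, diffOp (L j) ψ := by
    rw [← LinearMap.sum_apply, ← map_sum, hsum, map_one, Module.End.one_apply]
  conv_lhs => rw [hψ]
  rw [AddSubmonoidClass.coe_finsetSum, Finset.sum_apply]
  exact Finset.sum_congr rfl fun j _ => hc j y

end ConstantCoefficients

section Zeros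

variable {N : ℕ}

theorem trace_pow_eq_sum_eigenvalues_pow {B : Matrix (Fin N) (Fin N) ℂ} (hB : B.IsHermitian)
    (k : ℕ) : (B ^ k).trace = ∑ j, (hB.eigenvalues j : ℂ) ^ k := by
  conv_lhs => rw [hB.spectral_theorem, ← map_pow, Unitary.conjStarAlgAut_apply,
    Matrix.trace_mul_cycle, Unitary.coe_star_mul_self, one_mul, Matrix.diagonal_pow]
  simp [Matrix.trace]

theorem abs_eigenvalues_le_opNorm {B : Matrix (Fin N) (Fin N) ℂ} (hB : B.IsHermitian)
    (j : Fin N) : |hB.eigenvalues j| ≤ opNorm B := by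
  have h1 : Matrix.toEuclideanCLM (𝕜 := ℂ) B (hB.eigenvectorBasis j) =
      (hB.eigenvalues j : ℂ) • hB.eigenvectorBasis j := by
    ext i
    have h := congrFun (hB.mulVec_eigenvectorBasis j) i
    simpa using h
  have h2 := (Matrix.toEuclideanCLM (𝕜 := ℂ) B).le_opNorm (hB.eigenvectorBasis j)
  rw [h1, norm_smul, hB.eigenvectorBasis.norm_eq_one, mul_one, mul_one, Complex.norm_real] at h2
  exact h2

variable {μ : Measure (Matrix.unitaryGroup (Fin N) ℂ)} {B : Matrix (Fin N) (Fin N) ℂ} {t : ℂ}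

theorem hciz_diagonal (a : Fin N → ℝ) (z : ℂ) :
    hciz μ (Matrix.diagonal fun i => (a i : ℂ)) B z = orbitInt μ B (-(z * N)) 1 a := by
  simp only [hciz, orbitInt, laplaceInt, Pi.one_apply, one_mul]
  congr 1 with U
  congr 1
  have h : Matrix.diagonal (fun i => (a i : ℂ)) * (U : Matrix (Fin N) (Fin N) ℂ) * B *
      ((U⁻¹ : Matrix.unitaryGroup (Fin N) ℂ) : Matrix (Fin N) (Fin N) ℂ) =
      Matrix.diagonal (fun i => (a i : ℂ)) * conjMat B U := by
    simp only [conjMat, mul_assoc]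
    rfl
  rw [h]
  simp only [Matrix.trace, Matrix.diag_apply, Matrix.diagonal_mul, Finset.mul_sum,
    ← Finset.sum_neg_distrib]
  exact Finset.sum_congr rfl fun i _ => by ring

/-- The matrix of values of the exponentials `y ↦ exp (νⱼ y)` at the points `xₗ`. -/
noncomputable def expMatrix (ν : Fin N → ℂ) (x : Fin N → ℝ) : Matrix (Fin N) (Fin N) ℂ :=
  Matrix.of fun l j => Complex.exp (ν j * x l)

theorem continuous_expMatrix_det (ν : Fin N → ℂ) :
    Continuous fun x : Fin N → ℝ => (expMatrix ν x).det :=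
  Continuous.matrix_det (continuous_matrix fun l j => by
    simp only [expMatrix, Matrix.of_apply]
    fun_prop)

variable [IsFiniteMeasure μ] [μ.IsMulLeftInvariant]

theorem dressedInt_update_eq_zero (hB : B.IsHermitian) (hb : Function.Injective hB.eigenvalues)
    (ht : t ≠ 0) {x : Fin N → ℝ}
    (hdet : (expMatrix (fun j => t * hB.eigenvalues j) x).det ≠ 0) (h0 : orbitInt μ B t 1 x = 0)
    (i : Fin N) (y : ℝ) :
    (dressedInt μ B t : (Fin N → ℝ) → ℂ) (Function.update x i y) = 0 := by
  set ν : Fin N → ℂ := fun j => t * hB.eigenvalues j with hν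
  have hinj : Function.Injective ν := fun j k hjk =>
    hb (Complex.ofReal_injective (mul_left_cancel₀ ht hjk))
  have hann := diffOp_prod_X_sub_C_eq_zero (ψ := dressedInt μ B t) (ν := ν) (fun k => by
    rw [diffOp_psum_dressedInt, trace_pow_eq_sum_eigenvalues_pow hB, Finset.mul_sum]
    simp only [hν, mul_pow]) i
  obtain ⟨c, hc⟩ := exists_eq_sum_exp_of_diffOp_eq_zero hinj hann x
  have hzero : expMatrix ν x *ᵥ c = 0 := by
    funext l
    have h1 : (dressedInt μ B t : (Fin N → ℝ) → ℂ) (Function.update x i (x l)) = 0 := by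
      rw [dressedInt_apply]
      by_cases hl : l = i
      · rw [hl, Function.update_eq_self, h0, mul_zero]
      · rw [vandermondeProd_eq_zero_iff.2, zero_mul]
        exact fun h => hl (h (by simp [Function.update_of_ne hl]))
    rw [hc] at h1
    simpa [Matrix.mulVec, dotProduct, expMatrix, mul_comm] using h1
  have hc0 := Matrix.eq_zero_of_mulVec_eq_zero hdet hzero
  simp [hc, hc0]

theorem eventually_orbitInt_smul_eq_zero (hB : B.IsHermitian)
    (hb : Function.Injective hB.eigenvalues) (ht : t ≠ 0) {x : Fin N → ℝ}
    (hx : Function.Injective x)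
    (hdet : (expMatrix (fun j => t * hB.eigenvalues j) x).det ≠ 0)
    (h0 : orbitInt μ B t 1 x = 0) :
    ∀ᶠ s : ℝ in nhds 1, orbitInt μ B t 1 (s • x) = 0 := by
  have hgood : ∀ T : Finset (Fin N), ∀ᶠ s : ℝ in nhds 1,
      Function.Injective (T.piecewise (s • x) x) ∧
      (expMatrix (fun j => t * hB.eigenvalues j) (T.piecewise (s • x) x)).det ≠ 0 := fun T => by
    have hcont : Continuous fun s : ℝ => T.piecewise (s • x) x := by
      refine continuous_pi fun j => ?_
      by_cases hj : j ∈ T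
      · simp only [Finset.piecewise_eq_of_mem _ _ _ hj]
        fun_prop
      · simp only [Finset.piecewise_eq_of_notMem _ _ _ hj]
        fun_prop
    have hx1 : T.piecewise ((1 : ℝ) • x) x = x := by
      rw [one_smul, Finset.piecewise_same]
    have h1 := (contDiff_vandermondeProd.continuous.comp hcont).continuousAt.eventually_ne
      (x := (1 : ℝ)) (y := 0) (by
        rw [Function.comp_apply, hx1]
        exact fun h => vandermondeProd_eq_zero_iff.1 h hx)
    have h2 := ((continuous_expMatrix_det fun j => t * hB.eigenvalues j).comp
      hcont).continuousAt.eventually_ne (x := (1 : ℝ)) (y := 0) (by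
        rw [Function.comp_apply, hx1]
        exact hdet)
    filter_upwards [h1, h2] with s hs1 hs2
    exact ⟨not_not.1 (mt vandermondeProd_eq_zero_iff.2 hs1), hs2⟩
  have key : ∀ T : Finset (Fin N), ∀ᶠ s : ℝ in nhds 1,
      orbitInt μ B t 1 (T.piecewise (s • x) x) = 0 := fun T => by
    induction T using Finset.induction_on with
    | empty => simpa using h0
    | insert i T _ ih =>
      filter_upwards [ih, hgood T, hgood (insert i T)] with s hs h1 h2
      have h3 := dressedInt_update_eq_zero hB hb ht h1.2 hs i ((s • x) i)
      rw [← Finset.piecewise_insert, dressedInt_apply] at h3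
      exact (mul_eq_zero.1 h3).resolve_left fun h => vandermondeProd_eq_zero_iff.1 h h2.1
  simpa using key Finset.univ

end Zeros

section Conclusion

variable {N : ℕ} {μ : Measure (Matrix.unitaryGroup (Fin N) ℂ)} [IsProbabilityMeasure μ]
  {B : Matrix (Fin N) (Fin N) ℂ} {t : ℂ}

theorem orbitInt_one_zero : orbitInt μ B t 1 0 = 1 := by
  simp [orbitInt, laplaceInt]

theorem orbitInt_ne_zero_of_forall_smul [μ.IsMulLeftInvariant] (hB : B.IsHermitian)
    (hb : Function.Injective hB.eigenvalues) (ht : t ≠ 0) {a : Fin N → ℝ}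
    (ha : Function.Injective a)
    (hdet : ∀ s ∈ Set.Ioc (0 : ℝ) 1,
      (expMatrix (fun j => t * hB.eigenvalues j) (s • a)).det ≠ 0) :
    orbitInt μ B t 1 a ≠ 0 := by
  intro h0
  have hcont : Continuous fun s : ℝ => orbitInt μ B t 1 (s • a) :=
    (contDiff_orbitInt_one μ B t).continuous.comp (by fun_prop)
  have hcomp : IsCompact (Set.Icc (0 : ℝ) 1 ∩ (fun s : ℝ => orbitInt μ B t 1 (s • a)) ⁻¹' {0}) :=
    isCompact_Icc.inter_right (isClosed_singleton.preimage hcont)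
  obtain ⟨s, ⟨⟨hs0, hs1⟩, hs⟩, hmin⟩ := hcomp.exists_isLeast
    ⟨1, ⟨zero_le_one, le_rfl⟩, by simpa using h0⟩
  have hs : orbitInt μ B t 1 (s • a) = 0 := hs
  have hspos : 0 < s := lt_of_le_of_ne hs0 fun h => by
    rw [← h, zero_smul, orbitInt_one_zero] at hs
    exact one_ne_zero hs
  have hinj : Function.Injective (s • a) := (mul_right_injective₀ hspos.ne').comp ha
  have hev := eventually_orbitInt_smul_eq_zero hB hb ht hinj (hdet s ⟨hspos, hs1⟩) hs
  have hev' : ∀ᶠ r in nhdsWithin (1 : ℝ) (Set.Iio 1), r ∈ Set.Ioo (0 : ℝ) 1 :=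
    Ioo_mem_nhdsLT one_pos
  obtain ⟨r, hr, hr0, hr1⟩ := ((hev.filter_mono nhdsWithin_le_nhds).and hev').exists
  have hlt : r * s < s := mul_lt_of_lt_one_left hspos hr1
  refine absurd (hmin ⟨⟨by positivity, hlt.le.trans hs1⟩, ?_⟩) (not_le.2 hlt)
  rw [smul_smul] at hr
  exact hr

theorem expMatrix_det_ne_zero_of_arithmetic {ν : Fin N → ℂ} {x : Fin N → ℝ} {p q : ℝ}
    (hx : ∀ l, x l = p + q * (l : ℕ))
    (hν : ∀ j k, j ≠ k → ν j ≠ ν k ∧ ‖ν j - ν k‖ * |q| < 2 * Real.pi) (hq : q ≠ 0) :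
    (expMatrix ν x).det ≠ 0 := by
  have h1 : expMatrix ν x = Matrix.of fun l j => Complex.exp (ν j * p) *
      (Matrix.vandermonde fun j => Complex.exp (ν j * q))ᵀ l j := by
    ext l j
    simp only [expMatrix, Matrix.of_apply, Matrix.transpose_apply, Matrix.vandermonde_apply]
    rw [← Complex.exp_nat_mul, ← Complex.exp_add, hx]
    congr 1
    push_cast
    ring
  rw [h1, Matrix.det_mul_row, Matrix.det_transpose]
  refine mul_ne_zero (Finset.prod_ne_zero_iff.2 fun j _ => Complex.exp_ne_zero _)
    (Matrix.det_vandermonde_ne_zero_iff.2 fun j k hjk => ?_)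
  by_contra hne
  obtain ⟨h2, h3⟩ := hν j k hne
  obtain ⟨n, hn⟩ := Complex.exp_eq_exp_iff_exists_int.1 hjk
  have h4 : (ν j - ν k) * q = n * (2 * Real.pi * Complex.I) := by linear_combination hn
  have hq' : (q : ℂ) ≠ 0 := Complex.ofReal_ne_zero.2 hq
  rcases eq_or_ne n 0 with rfl | hn0
  · simp [sub_eq_zero, h2, hq] at h4
  · have h5 := congrArg norm h4
    simp only [norm_mul, Complex.norm_real, Complex.norm_intCast, Complex.norm_ofNat,
      Complex.norm_I, Real.norm_eq_abs, abs_of_pos Real.pi_pos, mul_one] at h5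
    have h6 : (1 : ℝ) ≤ |(n : ℝ)| := by exact_mod_cast Int.one_le_abs hn0
    nlinarith [Real.pi_pos]

end Conclusion

/-- If `A_N` is the diagonal matrix of classical locations of the uniform
measure on `[-M,M]` and `B` is Hermitian with distinct eigenvalues and
`‖B‖ ≤ M`, then every zero of `I_N(·;A_N,B)` has modulus at least `(π/2)M⁻²`. -/
theorem zeros_bounded_below (N : ℕ) (hN : 2 ≤ N) (M : ℝ) (hM : 0 < M)
    (μ : Measure (Matrix.unitaryGroup (Fin N) ℂ))
    (hμ : μ.IsHaarMeasure) (hμprob : IsProbabilityMeasure μ)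
    (B : Matrix (Fin N) (Fin N) ℂ) (hB : B.IsHermitian)
    (hBdist : Function.Injective hB.eigenvalues) (hBbd : opNorm B ≤ M) :
    ∀ z : ℂ,
      hciz μ (Matrix.diagonal fun i : Fin N =>
        ((-M + 2 * M * ((i : ℕ) + 1) / N : ℝ) : ℂ)) B z = 0 →
      Real.pi / 2 * (M ^ 2)⁻¹ ≤ ‖z‖ := by
  intro z hz
  by_contra! hlt
  rw [hciz_diagonal (fun i : Fin N => -M + 2 * M * ((i : ℕ) + 1) / N)] at hz
  have hNpos : (0 : ℝ) < N := by exact_mod_cast (by omega : 0 < N)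
  have hNne : (N : ℂ) ≠ 0 := by exact_mod_cast hNpos.ne'
  have hz4 : ‖z‖ * (4 * M ^ 2) < 2 * Real.pi := by
    rw [← div_eq_mul_inv, lt_div_iff₀ (by positivity)] at hlt
    linarith
  rcases eq_or_ne z 0 with rfl | hz0
  · simp [orbitInt, laplaceInt] at hz
  have ht : -(z * N) ≠ 0 := neg_ne_zero.2 (mul_ne_zero hz0 hNne)
  refine orbitInt_ne_zero_of_forall_smul hB hBdist ht (fun i j hij => ?_) (fun s hs => ?_) hz
  · have h1 : (((i : ℕ) : ℝ)) = (j : ℕ) := by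
      field_simp at hij
      nlinarith
    exact Fin.ext (by exact_mod_cast h1)
  · have hq : 0 < s * (2 * M / N) := by have := hs.1; positivity
    refine expMatrix_det_ne_zero_of_arithmetic (p := s * (-M + 2 * M / N))
      (q := s * (2 * M / N)) (fun l => ?_) (fun j k hjk => ⟨fun h => ?_, ?_⟩) hq.ne'
    · simp only [Pi.smul_apply, smul_eq_mul]
      ring
    · exact hjk (hBdist (Complex.ofReal_injective (mul_left_cancel₀ ht h)))
    · have hb : |hB.eigenvalues j - hB.eigenvalues k| ≤ 2 * M := by
        have h1 := (abs_eigenvalues_le_opNorm hB j).trans hBbd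
        have h2 := (abs_eigenvalues_le_opNorm hB k).trans hBbd
        linarith [abs_sub (hB.eigenvalues j) (hB.eigenvalues k)]
      rw [← mul_sub, ← Complex.ofReal_sub, norm_mul, norm_neg, norm_mul, Complex.norm_real,
        Complex.norm_natCast, Real.norm_eq_abs, abs_of_pos hq]
      calc ‖z‖ * N * |hB.eigenvalues j - hB.eigenvalues k| * (s * (2 * M / N))
          = ‖z‖ * (|hB.eigenvalues j - hB.eigenvalues k| * (2 * M)) * s := by field_simp
        _ ≤ ‖z‖ * (2 * M * (2 * M)) * 1 := by
            have := hs.1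
            gcongr
            exact hs.2
        _ = ‖z‖ * (4 * M ^ 2) := by ring
        _ < 2 * Real.pi := hz4

end HCIZ
end

section
/- Let A and B be N×N Hermitian matrices such that I_N(z;A,B) ≠ 0 for every z ∈ ℂ. Then at least one of A or B is a scalar multiple of the identity matrix. -/
open MeasureTheory Matrix

namespace HCIZ

/-- An entire function without zeros, of exponential type and equal to `1` at the origin,
is an exponential `z ↦ exp (a z)`. -/
theorem exists_eq_cexp_mul_of_ne_zero_of_norm_le {f : ℂ → ℂ} (hf : Differentiable ℂ f)
    (hne : ∀ z, f z ≠ 0) (h0 : f 0 = 1) {C : ℝ} (hC : 0 < C)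
    (hbound : ∀ z, ‖f z‖ ≤ Real.exp (C * ‖z‖)) : ∃ a : ℂ, ∀ z, f z = Complex.exp (a * z) := by
  have hdf : Differentiable ℂ (deriv f) := fun z =>
    ((hf.analyticAt z).deriv).differentiableAt
  obtain ⟨g, hg0, hg⟩ :=
    (Differentiable.isExactOn_univ (hdf.div hf hne)).with_val_at 0 0
  replace hg : ∀ z, HasDerivAt g (deriv f z / f z) z := fun z => hg z trivial
  have hgd : Differentiable ℂ g := fun z => (hg z).differentiableAt
  have hfg : ∀ z, f z = Complex.exp (g z) := by
    intro z
    have hder : ∀ w, HasDerivAt (fun w => f w * Complex.exp (-g w)) 0 w := by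
      intro w
      convert! (hf w).hasDerivAt.mul (hg w).neg.cexp using 1
      field_simp [hne w]
      ring
    have hconst := is_const_of_deriv_eq_zero (fun w => (hder w).differentiableAt)
      (fun w => (hder w).deriv) z 0
    simp only [hg0, h0, neg_zero, Complex.exp_zero, mul_one, Complex.exp_neg] at hconst
    exact (mul_inv_eq_one₀ (Complex.exp_ne_zero _)).mp hconst
  have hre : ∀ z, (g z).re ≤ C * ‖z‖ := by
    intro z
    have h := hbound z
    rwa [hfg, Complex.norm_exp, Real.exp_le_exp] at h
  have hlin : ∀ z, ‖g z‖ ≤ 4 * C * ‖z‖ := by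
    intro z
    rcases eq_or_ne z 0 with rfl | hz
    · simp [hg0]
    have hz' : 0 < ‖z‖ := norm_pos_iff.mpr hz
    have h := Complex.borelCaratheodory_zero (f := g) (M := C * (2 * ‖z‖)) (R := 2 * ‖z‖) (z := z)
      (by positivity) hgd.differentiableOn
      (fun w hw => (hre w).trans (by
        have := mem_ball_zero_iff.mp hw
        gcongr)) (by positivity) (mem_ball_zero_iff.mpr (by linarith)) hg0
    refine h.trans (le_of_eq ?_)
    field_simp
    ring
  have hslope : ∀ z, z ≠ 0 → dslope g 0 z = g z / z := fun z hz => by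
    rw [dslope_of_ne _ hz, slope_def_field, hg0, sub_zero, sub_zero]
  have hqd : Differentiable ℂ (dslope g 0) := by
    rw [← differentiableOn_univ, Complex.differentiableOn_dslope Filter.univ_mem]
    exact hgd.differentiableOn
  have hqb : ∀ z, ‖dslope g 0 z‖ ≤ 4 * C := by
    have hdense : Dense ({0}ᶜ : Set ℂ) := dense_compl_singleton 0
    refine fun z => hdense.induction (fun w hw => ?_)
      (isClosed_le hqd.continuous.norm continuous_const) z
    rw [hslope w hw, norm_div, div_le_iff₀ (norm_pos_iff.mpr hw)]
    exact hlin w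
  refine ⟨dslope g 0 0, fun z => ?_⟩
  rw [hfg]
  congr 1
  rcases eq_or_ne z 0 with rfl | hz
  · simp [hg0]
  have hb : Bornology.IsBounded (Set.range (dslope g 0)) :=
    isBounded_iff_forall_norm_le.mpr ⟨4 * C, by rintro _ ⟨w, rfl⟩; exact hqb w⟩
  rw [hqd.apply_eq_apply_of_bounded hb 0 z, hslope z hz, div_mul_cancel₀ _ hz]

open ProbabilityTheory in
/-- A bounded random variable whose complex moment generating function has no zeros is
almost surely constant. -/
theorem ae_eq_const_of_complexMGF_ne_zero {Ω : Type*} {mΩ : MeasurableSpace Ω} {μ : Measure Ω}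
    [IsProbabilityMeasure μ] {X : Ω → ℝ} (hX : AEMeasurable X μ) {C : ℝ}
    (hC : ∀ ω, |X ω| ≤ C) (hne : ∀ z, complexMGF X μ z ≠ 0) :
    ∃ c : ℝ, ∀ᵐ ω ∂μ, X ω = c := by
  have hint : ∀ t : ℝ, Integrable (fun ω => Real.exp (t * X ω)) μ := fun t =>
    integrable_exp_mul_of_mem_Icc hX (ae_of_all _ fun ω => abs_le.mp (hC ω))
  have huniv : integrableExpSet X μ = Set.univ := Set.eq_univ_of_forall hint
  have hmem : ∀ z : ℂ, z.re ∈ interior (integrableExpSet X μ) := by simp [huniv]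
  have hbound : ∀ z, ‖complexMGF X μ z‖ ≤ Real.exp ((|C| + 1) * ‖z‖) := by
    intro z
    refine norm_complexMGF_le_mgf.trans ?_
    have hle : ∀ ω, Real.exp (z.re * X ω) ≤ Real.exp ((|C| + 1) * ‖z‖) := by
      intro ω
      rw [Real.exp_le_exp]
      calc z.re * X ω ≤ |z.re| * |X ω| := by rw [← abs_mul]; exact le_abs_self _
        _ ≤ ‖z‖ * (|C| + 1) := by
          gcongr
          · exact Complex.abs_re_le_norm z
          · linarith [hC ω, le_abs_self C]
        _ = (|C| + 1) * ‖z‖ := mul_comm _ _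
    simpa [mgf] using integral_mono (hint z.re) (integrable_const _) hle
  obtain ⟨a, ha⟩ := exists_eq_cexp_mul_of_ne_zero_of_norm_le
    (fun z => (hasDerivAt_complexMGF (hmem z)).differentiableAt) hne (by simp [complexMGF])
    (by positivity) hbound
  have hmean : a = ((∫ ω, X ω ∂μ : ℝ) : ℂ) := by
    have h1 : HasDerivAt (complexMGF X μ) a 0 := by
      rw [funext ha]
      simpa using ((hasDerivAt_id (0 : ℂ)).const_mul a).cexp
    have h2 := h1.unique (hasDerivAt_complexMGF (hmem 0))
    simpa [integral_complex_ofReal] using h2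
  refine ⟨∫ ω, X ω ∂μ, ?_⟩
  set m := ∫ ω, X ω ∂μ
  have hmap : μ.map X = μ.map (fun _ => m) := by
    refine Measure.ext_of_complexMGF_eq hX aemeasurable_const (funext fun z => ?_)
    rw [ha, hmean]
    simp [complexMGF, mul_comm]
  have hae : ∀ᵐ x ∂μ.map X, x = m := by
    rw [hmap, ae_map_iff (p := fun x => x = m) aemeasurable_const (measurableSet_singleton m)]
    simp
  exact ae_of_ae_map hX hae

/-- The trace of the product of two diagonal matrices, one conjugated by a permutation matrix. -/
theorem trace_diagonal_mul_permMatrix_conj {n R : Type*} [Fintype n] [DecidableEq n] [CommRing R]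
    [StarRing R] (d e : n → R) (σ : Equiv.Perm n) :
    (diagonal d * σ.permMatrix R * diagonal e * (σ.permMatrix R)ᴴ).trace = ∑ i, d i * e (σ i) := by
  refine Finset.sum_congr rfl fun i _ => ?_
  rw [diag_apply, mul_apply, Finset.sum_eq_single (σ i)]
  · simp [Equiv.Perm.permMatrix, PEquiv.toMatrix_apply, mul_diagonal]
  · intro j _ hj
    simp [Equiv.Perm.permMatrix, PEquiv.toMatrix_apply, hj.symm, mul_diagonal]
  · simp

theorem permMatrix_mem_unitaryGroup {n R : Type*} [Fintype n] [DecidableEq n] [CommRing R]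
    [StarRing R] (σ : Equiv.Perm n) : σ.permMatrix R ∈ unitaryGroup n R := by
  rw [mem_unitaryGroup_iff, star_eq_conjTranspose, conjTranspose_permMatrix, ← permMatrix_mul]
  simp

/-- If all rearrangements of `∑ i, d i * e i` agree, then `d` or `e` is constant. -/
theorem forall_eq_or_forall_eq_of_sum_mul_perm_eq {n R : Type*} [Fintype n] [DecidableEq n]
    [CommRing R] [IsDomain R] {d e : n → R} {c : R}
    (h : ∀ σ : Equiv.Perm n, ∑ i, d i * e (σ i) = c) :
    (∀ i j, d i = d j) ∨ ∀ i j, e i = e j := by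
  by_contra! hcon
  obtain ⟨⟨i, j, hij⟩, k, l, hkl⟩ := hcon
  have hij' : i ≠ j := fun h => hij (h ▸ rfl)
  have hkl' : k ≠ l := fun h => hkl (h ▸ rfl)
  obtain ⟨σ, hi, hj⟩ : ∃ σ : Equiv.Perm n, σ i = k ∧ σ j = l := by
    refine ⟨Equiv.swap (Equiv.swap i k j) l * Equiv.swap i k, ?_, by simp⟩
    have hne : k ≠ Equiv.swap i k j := fun hk =>
      hij' ((Equiv.swap i k).injective ((Equiv.swap_apply_left i k).trans hk))
    simp [Equiv.swap_apply_of_ne_of_ne hne hkl']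
  have key : ∑ x, (d x * e (σ x) - d x * e ((σ * Equiv.swap i j) x)) = 0 := by
    rw [Finset.sum_sub_distrib, h, h, sub_self]
  rw [Fintype.sum_eq_add i j hij'] at key
  · simp only [Equiv.Perm.mul_apply, Equiv.swap_apply_left, Equiv.swap_apply_right, hi, hj] at key
    have hprod : (d i - d j) * (e k - e l) = 0 := by linear_combination key
    rcases mul_eq_zero.mp hprod with h0 | h0
    · exact hij (sub_eq_zero.mp h0)
    · exact hkl (sub_eq_zero.mp h0)
  · rintro x ⟨hxi, hxj⟩
    simp [Equiv.swap_apply_of_ne_of_ne hxi hxj]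

/-- A Hermitian matrix whose eigenvalues all agree is scalar. -/
theorem exists_eq_smul_one_of_eigenvalues_eq {n : Type*} [Fintype n] [DecidableEq n]
    {A : Matrix n n ℂ} (hA : A.IsHermitian) (h : ∀ i j, hA.eigenvalues i = hA.eigenvalues j) :
    ∃ c : ℂ, A = c • (1 : Matrix n n ℂ) := by
  rcases isEmpty_or_nonempty n with hn | ⟨⟨i⟩⟩
  · exact ⟨0, Subsingleton.elim _ _⟩
  refine ⟨hA.eigenvalues i, ?_⟩
  have hdiag : diagonal (RCLike.ofReal ∘ hA.eigenvalues) =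
      (hA.eigenvalues i : ℂ) • (1 : Matrix n n ℂ) := by
    rw [smul_one_eq_diagonal]
    congr 1
    funext j
    simp [h j i]
  conv_lhs => rw [hA.spectral_theorem, hdiag]
  rw [map_smul, map_one]

/-- If `Tr (A U B U⁻¹)` is constant over the unitary group, then `A` or `B` is scalar. -/
theorem scalar_or_scalar_of_trace_conj_eq {n : Type*} [Fintype n] [DecidableEq n]
    {A B : Matrix n n ℂ} (hA : A.IsHermitian) (hB : B.IsHermitian) {c : ℂ}
    (h : ∀ U : unitaryGroup n ℂ,
      (A * (U : Matrix n n ℂ) * B * ((U⁻¹ : unitaryGroup n ℂ) : Matrix n n ℂ)).trace = c) :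
    (∃ c : ℂ, A = c • (1 : Matrix n n ℂ)) ∨ ∃ c : ℂ, B = c • (1 : Matrix n n ℂ) := by
  have hperm : ∀ σ : Equiv.Perm n,
      ∑ i, (hA.eigenvalues i : ℂ) * (hB.eigenvalues (σ i) : ℂ) = c := by
    intro σ
    set V := hA.eigenvectorUnitary
    set W := hB.eigenvectorUnitary
    set P : unitaryGroup n ℂ := ⟨σ.permMatrix ℂ, permMatrix_mem_unitaryGroup σ⟩
    set D : Matrix n n ℂ := diagonal (RCLike.ofReal ∘ hA.eigenvalues)
    set E : Matrix n n ℂ := diagonal (RCLike.ofReal ∘ hB.eigenvalues)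
    have hV : star (V : Matrix n n ℂ) * V = 1 := Unitary.coe_star_mul_self V
    have hW : star (W : Matrix n n ℂ) * W = 1 := Unitary.coe_star_mul_self W
    have hAeq : A = V * D * star (V : Matrix n n ℂ) := hA.spectral_theorem
    have hBeq : B = W * E * star (W : Matrix n n ℂ) := hB.spectral_theorem
    have hcalc : A * ((V * P * star W : unitaryGroup n ℂ) : Matrix n n ℂ) * B *
        (((V * P * star W)⁻¹ : unitaryGroup n ℂ) : Matrix n n ℂ) =
        V * (D * P * E * star (P : Matrix n n ℂ)) * star (V : Matrix n n ℂ) := by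
      have hinv : (((V * P * star W)⁻¹ : unitaryGroup n ℂ) : Matrix n n ℂ) =
          W * star (P : Matrix n n ℂ) * star (V : Matrix n n ℂ) := by
        simp [← Unitary.star_eq_inv, mul_assoc]
      rw [hinv, hAeq, hBeq]
      simp only [Submonoid.coe_mul, Unitary.coe_star]
      calc _ = V * D * (star (V : Matrix n n ℂ) * V) * P * (star (W : Matrix n n ℂ) * W) * E *
            (star (W : Matrix n n ℂ) * W) * star (P : Matrix n n ℂ) * star (V : Matrix n n ℂ) := by
            simp only [mul_assoc]
        _ = _ := by simp only [hV, hW, mul_one, mul_assoc]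
    have htr := h (V * P * star W)
    rw [hcalc, trace_mul_comm, ← mul_assoc, hV, one_mul] at htr
    rw [← htr]
    exact (trace_diagonal_mul_permMatrix_conj (fun i => (hA.eigenvalues i : ℂ))
      (fun i => (hB.eigenvalues i : ℂ)) σ).symm
  rcases forall_eq_or_forall_eq_of_sum_mul_perm_eq
      (d := fun i => (hA.eigenvalues i : ℂ)) (e := fun i => (hB.eigenvalues i : ℂ)) hperm with h | h
  · exact .inl (exists_eq_smul_one_of_eigenvalues_eq hA fun i j => by exact_mod_cast h i j)
  · exact .inr (exists_eq_smul_one_of_eigenvalues_eq hB fun i j => by exact_mod_cast h i j)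

theorem im_trace_conj_eq_zero {n : Type*} [Fintype n] [DecidableEq n]
    {A B : Matrix n n ℂ} (hA : A.IsHermitian) (hB : B.IsHermitian) (U : unitaryGroup n ℂ) :
    (A * (U : Matrix n n ℂ) * B * ((U⁻¹ : unitaryGroup n ℂ) : Matrix n n ℂ)).trace.im = 0 := by
  rw [← Complex.conj_eq_iff_im, starRingEnd_apply, ← trace_conjTranspose]
  simp only [← Unitary.star_eq_inv, Unitary.coe_star, star_eq_conjTranspose, conjTranspose_mul,
    conjTranspose_conjTranspose, hA.eq, hB.eq]
  rw [← mul_assoc, ← mul_assoc, trace_mul_comm, ← mul_assoc, ← mul_assoc]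

theorem isClosed_unitaryGroup (n : Type*) [Fintype n] [DecidableEq n] :
    IsClosed (unitaryGroup n ℂ : Set (Matrix n n ℂ)) :=
  isClosed_unitary

open scoped Matrix.Norms.Elementwise in
theorem isCompact_unitaryGroup (n : Type*) [Fintype n] [DecidableEq n] :
    IsCompact (unitaryGroup n ℂ : Set (Matrix n n ℂ)) :=
  have : ProperSpace (Matrix n n ℂ) := inferInstanceAs (ProperSpace (n → n → ℂ))
  Metric.isCompact_of_isClosed_isBounded (isClosed_unitaryGroup n)
    (isBounded_iff_forall_norm_le.mpr ⟨1, fun _ hU => entrywise_sup_norm_bound_of_unitary hU⟩)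

/-- If the HCIZ integral of a pair of Hermitian matrices has no zeros at all,
then one of the two matrices is a scalar multiple of the identity. -/
theorem nonvanishing_implies_scalar (N : ℕ)
    (μ : Measure (Matrix.unitaryGroup (Fin N) ℂ))
    (hμ : μ.IsHaarMeasure) (hμprob : IsProbabilityMeasure μ)
    (A B : Matrix (Fin N) (Fin N) ℂ)
    (hA : A.IsHermitian) (hB : B.IsHermitian)
    (hnz : ∀ z : ℂ, hciz μ A B z ≠ 0) :
    (∃ c : ℂ, A = c • (1 : Matrix (Fin N) (Fin N) ℂ)) ∨
    (∃ c : ℂ, B = c • (1 : Matrix (Fin N) (Fin N) ℂ)) := by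
  rcases Nat.eq_zero_or_pos N with rfl | hN
  · exact .inl ⟨0, Subsingleton.elim _ _⟩
  have hN0 : (N : ℂ) ≠ 0 := by exact_mod_cast hN.ne'
  have : CompactSpace (unitaryGroup (Fin N) ℂ) :=
    isCompact_iff_compactSpace.mp (isCompact_unitaryGroup (Fin N))
  set T : unitaryGroup (Fin N) ℂ → ℂ := fun U =>
    (A * (U : Matrix (Fin N) (Fin N) ℂ) * B *
      ((U⁻¹ : unitaryGroup (Fin N) ℂ) : Matrix (Fin N) (Fin N) ℂ)).trace
  have hTcont : Continuous T := by
    have hinv : Continuous fun U : unitaryGroup (Fin N) ℂ =>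
        ((U⁻¹ : unitaryGroup (Fin N) ℂ) : Matrix (Fin N) (Fin N) ℂ) :=
      continuous_subtype_val.comp continuous_inv
    have hcoe : Continuous fun U : unitaryGroup (Fin N) ℂ => (U : Matrix (Fin N) (Fin N) ℂ) :=
      continuous_subtype_val
    exact (((continuous_const.matrix_mul hcoe).matrix_mul continuous_const).matrix_mul
      hinv).matrix_trace
  have hTre : ∀ U, T U = ((T U).re : ℂ) := fun U =>
    Complex.ext rfl (im_trace_conj_eq_zero hA hB U)
  have hXcont : Continuous fun U => (T U).re := Complex.continuous_re.comp hTcont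
  obtain ⟨C, hC⟩ := isCompact_univ.exists_bound_of_continuousOn hXcont.continuousOn
  have hmgf : ∀ z, ProbabilityTheory.complexMGF (fun U => (T U).re) μ z ≠ 0 := by
    intro z
    convert! hnz (-z / N) using 1
    refine integral_congr_ae (ae_of_all _ fun U => ?_)
    change Complex.exp (z * ((T U).re : ℂ)) = Complex.exp (-(-z / N * N * T U))
    rw [← hTre U, div_mul_cancel₀ _ hN0, neg_mul, neg_neg]
  obtain ⟨c, hc⟩ := ae_eq_const_of_complexMGF_ne_zero hXcont.measurable.aemeasurable
    (fun U => hC U trivial) hmgf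
  have hconst : (fun U => (T U).re) = fun _ => c :=
    (hXcont.ae_eq_iff_eq μ continuous_const).mp hc
  exact scalar_or_scalar_of_trace_conj_eq hA hB (c := (c : ℂ)) fun U =>
    (hTre U).trans (congrArg _ (congrFun hconst U))

end HCIZ
end
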